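/- Let N≥2 and 1<q≤1*=N/(N−1). If {u_k} is a bounded sequence in BV̇(R^N) such that for every sequence {(j_k,y_k)}⊂Z×R^N one has g[j_k,y_k]u_k ⇀ 0 weakly in BV̇(R^N), then ‖u_k‖_{L^{1*,q}(R^N)} → 0. In other words, the embedding BV̇(R^N) ↪ L^{1*,q}(R^N) is cocompact with respect to the group D. -/

import Mathlib

open MeasureTheory Set Filter Topology ENNReal

noncomputable section

abbrev Euc (N : ℕ) := EuclideanSpace ℝ (Fin N)

/-- Decreasing rearrangement of `u` with respect to Lebesgue measure on `ℝ^N`. -/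
def rearr (N : ℕ) (u : Euc N → ℝ) (t : ℝ) : ℝ :=
  sInf {l : ℝ | 0 < l ∧ volume {x : Euc N | l < |u x|} ≤ ENNReal.ofReal t}

/-- Lorentz quasinorm `‖u‖_{L^{p,q}}` on `ℝ^N` (with `q = ∞` allowed). -/
def lorentz (N : ℕ) (p : ℝ) (q : ℝ≥0∞) (u : Euc N → ℝ) : ℝ≥0∞ :=
  if q = ∞ then ⨆ t ∈ Ioi (0:ℝ), ENNReal.ofReal (t ^ (1/p) * rearr N u t)
  else (∫⁻ t in Ioi (0:ℝ),
      ENNReal.ofReal ((t ^ (1/p) * rearr N u t) ^ q.toReal / t)) ^ (1 / q.toReal)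

/-- Divergence of a vector field on `ℝ^N`. -/
def divg (N : ℕ) (v : Euc N → Euc N) (x : Euc N) : ℝ :=
  ∑ i : Fin N, fderiv ℝ v x (EuclideanSpace.single i 1) i

/-- Total variation `‖Du‖_Ω` of `u` over a set `Ω`. -/
def TV (N : ℕ) (u : Euc N → ℝ) (Ω : Set (Euc N)) : ℝ≥0∞ :=
  ⨆ (v : Euc N → Euc N) (_ : ContDiff ℝ (⊤ : ℕ∞) v) (_ : HasCompactSupport v)
    (_ : ∀ x, ‖v x‖ ≤ 1) (_ : tsupport v ⊆ Ω),
    ENNReal.ofReal (∫ x, u x * divg N v x)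

/-- `u` vanishes at infinity. -/
def VanishAtInfinity (N : ℕ) (u : Euc N → ℝ) : Prop :=
  ∀ M : ℝ, 0 < M → volume {x : Euc N | M < |u x|} < ∞

/-- Membership in `BV̇(ℝ^N)`. -/
def MemBVdot (N : ℕ) (u : Euc N → ℝ) : Prop :=
  Measurable u ∧ VanishAtInfinity N u ∧ TV N u univ < ∞

/-- The rescaling `g[j,y]u = 2^{(N-1)j} u (2^j (· - y))`. -/
def resc (N : ℕ) (j : ℤ) (y : Euc N) (u : Euc N → ℝ) : Euc N → ℝ :=
  fun x => (2:ℝ) ^ (((N:ℤ) - 1) * j) * u ((2:ℝ) ^ j • (x - y))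

/-- Weak convergence `u k ⇀ w` in `BV̇(ℝ^N)`. -/
def WeakBVconv (N : ℕ) (u : ℕ → Euc N → ℝ) (w : Euc N → ℝ) : Prop :=
  (∀ K : Set (Euc N), IsCompact K →
      Tendsto (fun k => ∫ x in K, |u k x - w x|) atTop (𝓝 0)) ∧
  ∀ i : Fin N, ∀ f : Euc N → ℝ, ContDiff ℝ (⊤ : ℕ∞) f → HasCompactSupport f →
      Tendsto (fun k => ∫ x, u k x * fderiv ℝ f x (EuclideanSpace.single i 1)) atTop
        (𝓝 (∫ x, w x * fderiv ℝ f x (EuclideanSpace.single i 1)))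

lemma integral_mul_divg_le_TV {N : ℕ} {u : Euc N → ℝ} (hTV : TV N u univ ≠ ∞)
    {v : Euc N → Euc N} (hv : ContDiff ℝ (⊤ : ℕ∞) v) (hc : HasCompactSupport v)
    (hb : ∀ x, ‖v x‖ ≤ 1) : ∫ x, u x * divg N v x ≤ (TV N u univ).toReal := by
  rw [← ENNReal.ofReal_le_iff_le_toReal hTV, TV]
  exact le_iSup_of_le v (le_iSup_of_le hv (le_iSup_of_le hc (le_iSup_of_le hb
    (le_iSup_of_le (subset_univ _) le_rfl))))

lemma divg_smul_const {N : ℕ} {ψ : Euc N → ℝ} (hψ : Differentiable ℝ ψ) (e x : Euc N) :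
    divg N (fun y => ψ y • e) x = fderiv ℝ ψ x e := by
  have h1 : ∀ w : Euc N, fderiv ℝ (fun y => ψ y • e) x w = fderiv ℝ ψ x w • e := by
    intro w
    rw [fderiv_smul_const (hψ x)]
    rfl
  have h2 : e = ∑ i : Fin N, e i • EuclideanSpace.single i (1 : ℝ) := by
    ext j
    simp [Finset.sum_apply, Pi.single_apply]
  unfold divg
  simp only [h1]
  conv_rhs => rw [h2, map_sum]
  refine Finset.sum_congr rfl fun i _ => ?_
  simp [mul_comm]

lemma abs_integral_mul_fderiv_le_TV {N : ℕ} {u : Euc N → ℝ} (hTV : TV N u univ ≠ ∞)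
    {ψ : Euc N → ℝ} (hψ : ContDiff ℝ (⊤ : ℕ∞) ψ) (hc : HasCompactSupport ψ)
    (hb : ∀ x, |ψ x| ≤ 1) (h : Euc N) :
    |∫ x, u x * fderiv ℝ ψ x h| ≤ (TV N u univ).toReal * ‖h‖ := by
  have hd : Differentiable ℝ ψ := hψ.differentiable (by simp)
  have unit_bound : ∀ e : Euc N, ‖e‖ ≤ 1 →
      ∫ x, u x * fderiv ℝ ψ x e ≤ (TV N u univ).toReal := by
    intro e he
    have := integral_mul_divg_le_TV hTV (v := fun y => ψ y • e) (hψ.smul contDiff_const)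
      hc.smul_right (fun x => by
        rw [norm_smul, Real.norm_eq_abs]
        exact mul_le_one₀ (hb x) (norm_nonneg _) he)
    simpa only [divg_smul_const hd] using this
  rcases eq_or_ne h 0 with rfl | hne
  · simp
  have hpos : 0 < ‖h‖ := norm_pos_iff.2 hne
  have hscale : ∀ x, u x * fderiv ℝ ψ x h = ‖h‖ * (u x * fderiv ℝ ψ x (‖h‖⁻¹ • h)) := by
    intro x
    rw [map_smul, smul_eq_mul]
    field_simp
  have hnorm : ‖‖h‖⁻¹ • h‖ ≤ 1 := by
    rw [norm_smul, norm_inv, norm_norm, inv_mul_cancel₀ hpos.ne']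
  simp only [hscale]
  rw [integral_const_mul, abs_mul, abs_of_pos hpos, mul_comm]
  refine mul_le_mul_of_nonneg_right (abs_le.2 ⟨?_, unit_bound _ hnorm⟩) hpos.le
  have := unit_bound (-(‖h‖⁻¹ • h)) (by rwa [norm_neg])
  simp only [map_neg, mul_neg, integral_neg] at this
  linarith

lemma abs_convolution_sub_le_TV {N : ℕ} {u : Euc N → ℝ} (hu : LocallyIntegrable u)
    (hTV : TV N u univ ≠ ∞)
    {φ : Euc N → ℝ} (hφ : ContDiff ℝ (⊤ : ℕ∞) φ) (hc : HasCompactSupport φ)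
    (hb : ∀ x, |φ x| ≤ 1) (h : Euc N) :
    |(∫ t, u t * φ (h - t)) - ∫ t, u t * φ (0 - t)| ≤ (TV N u univ).toReal * ‖h‖ := by
  set L := ContinuousLinearMap.lsmul ℝ ℝ (E := ℝ)
  have hG : ∀ z, (convolution u φ L volume) z = ∫ t, u t * φ (z - t) := fun z => rfl
  have hder : ∀ z, HasFDerivAt (convolution u φ L volume)
      ((convolution u (fderiv ℝ φ) (L.precompR (Euc N)) volume) z) z := fun z =>
    hc.hasFDerivAt_convolution_right L hu (hφ.of_le (by simp)) z
  have hbd : ∀ z, ‖(convolution u (fderiv ℝ φ) (L.precompR (Euc N)) volume) z‖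
      ≤ (TV N u univ).toReal := by
    intro z
    refine ContinuousLinearMap.opNorm_le_bound _ ENNReal.toReal_nonneg fun w => ?_
    rw [convolution_precompR_apply L hu (hc.fderiv ℝ) (hφ.continuous_fderiv (by simp))]
    have hχd : ∀ t, fderiv ℝ (fun t => φ (z - t)) t w = - fderiv ℝ φ (z - t) w := by
      intro t
      have hd : DifferentiableAt ℝ φ (z - t) := hφ.differentiable (by simp) _
      have h1 : HasFDerivAt (fun t : Euc N => z - t) (-(ContinuousLinearMap.id ℝ (Euc N))) t :=
        (hasFDerivAt_id t).const_sub z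
      have := (hd.hasFDerivAt.comp t h1).fderiv
      rw [show (fun t => φ (z - t)) = φ ∘ (fun t => z - t) from rfl, this]
      simp
    have key := abs_integral_mul_fderiv_le_TV (u := u) hTV (ψ := fun t => φ (z - t))
      (hφ.comp (contDiff_const.sub contDiff_id))
      (hc.comp_homeomorph (Homeomorph.subLeft z)) (fun x => hb _) w
    simp only [hχd, mul_neg, integral_neg, abs_neg] at key
    exact key
  have := (convex_univ (𝕜 := ℝ) (E := Euc N)).norm_image_sub_le_of_norm_hasFDerivWithin_le
    (f := convolution u φ L volume) (fun z _ => (hder z).hasFDerivWithinAt)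
    (fun z _ => hbd z) (mem_univ 0) (mem_univ h)
  simpa only [hG, sub_zero, Real.norm_eq_abs] using this

/-- A bound on the pairings with test functions bounded by one is a bound on the `L¹` norm. -/
lemma lintegral_enorm_le_of_forall_test {N : ℕ} {g : Euc N → ℝ} (hg : LocallyIntegrable g)
    (hgm : Measurable g) {A : ℝ}
    (hA : ∀ ψ : Euc N → ℝ, ContDiff ℝ (⊤ : ℕ∞) ψ → HasCompactSupport ψ → (∀ x, |ψ x| ≤ 1) →
      ∫ x, g x * ψ x ≤ A) :
    ∫⁻ x, ‖g x‖ₑ ≤ ENNReal.ofReal A := by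
  have ball_bound : ∀ n : ℕ, ∫⁻ x in Metric.ball (0 : Euc N) n, ‖g x‖ₑ ≤ ENNReal.ofReal A := by
    intro n
    set B := Metric.ball (0 : Euc N) n
    set σ : Euc N → ℝ := B.indicator fun x => SignType.sign (g x)
    have hσm : Measurable σ := by
      refine Measurable.indicator ?_ measurableSet_ball
      have : Measurable (fun y : ℝ => ((SignType.sign y : SignType) : ℝ)) := by
        have : (fun y : ℝ => ((SignType.sign y : SignType) : ℝ))
            = fun y => if 0 < y then 1 else if y < 0 then -1 else 0 := by
          ext y
          simp only [sign_apply]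
          split_ifs <;> simp
        rw [this]
        exact Measurable.ite measurableSet_Ioi measurable_const
          (Measurable.ite measurableSet_Iio measurable_const measurable_const)
      exact this.comp hgm
    have hσ1 : ∀ x, ‖σ x‖ ≤ 1 := by
      intro x
      simp only [σ, indicator]
      split_ifs
      · rcases h : SignType.sign (g x) <;> simp
      · simp
    have hσB : ∀ x, x ∉ B → σ x = 0 := fun x hx => indicator_of_notMem hx _
    have hσi : Integrable σ := by
      refine Measure.integrableOn_of_bounded (s := B) (M := 1) ?_ ?_ ?_ |>.integrable_of_forall_notMem_eq_zero hσB
      · exact measure_ball_lt_top.ne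
      · exact hσm.aestronglyMeasurable
      · exact Eventually.of_forall hσ1
    have hσc : HasCompactSupport σ :=
      HasCompactSupport.intro (isCompact_closedBall (0 : Euc N) n) fun x hx =>
        hσB x fun h => hx (Metric.ball_subset_closedBall h)
    let φ : ℕ → ContDiffBump (0 : Euc N) := fun m =>
      ⟨1 / (2 * (m + 1)), 1 / (m + 1), by positivity, by
        apply one_div_lt_one_div_of_lt <;> nlinarith [(m.cast_nonneg : (0:ℝ) ≤ m)]⟩
    let ψ : ℕ → Euc N → ℝ := fun m =>
      convolution ((φ m).normed volume) σ (ContinuousLinearMap.lsmul ℝ ℝ) volume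
    have hψs : ∀ m, ContDiff ℝ (⊤ : ℕ∞) (ψ m) := fun m =>
      (φ m).hasCompactSupport_normed.contDiff_convolution_left _ (φ m).contDiff_normed
        hσi.locallyIntegrable
    have hψc : ∀ m, HasCompactSupport (ψ m) := fun m =>
      HasCompactSupport.convolution _ (φ m).hasCompactSupport_normed hσc
    have hψ1 : ∀ m x, |ψ m x| ≤ 1 := by
      intro m x
      rw [← Real.norm_eq_abs]
      calc ‖ψ m x‖ ≤ ∫ t, (φ m).normed volume t := by
            refine norm_integral_le_of_norm_le (φ m).integrable_normed (Eventually.of_forall ?_)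
            intro t
            simp only [ContinuousLinearMap.lsmul_apply, norm_smul]
            rw [Real.norm_of_nonneg ((φ m).nonneg_normed t)]
            exact mul_le_of_le_one_right ((φ m).nonneg_normed t) (hσ1 _)
        _ = 1 := (φ m).integral_normed
    have hψsupp : ∀ m x, x ∉ Metric.ball (0 : Euc N) (n + 1) → ψ m x = 0 := by
      intro m x hx
      refine integral_eq_zero_of_ae (Eventually.of_forall fun t => ?_)
      by_cases ht : t ∈ Metric.ball (0 : Euc N) (φ m).rOut
      · have : x - t ∉ B := by
          intro hb
          apply hx
          simp only [B, Metric.mem_ball, dist_zero_right] at hb ht ⊢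
          have h1 : (φ m).rOut ≤ 1 := by
            change 1 / ((m : ℝ) + 1) ≤ 1
            rw [div_le_one (by positivity)]
            linarith [(m.cast_nonneg : (0:ℝ) ≤ m)]
          calc ‖x‖ = ‖(x - t) + t‖ := by simp
            _ ≤ ‖x - t‖ + ‖t‖ := norm_add_le _ _
            _ < n + 1 := by linarith
        simp [hσB _ this]
      · rw [← (φ m).support_normed_eq (μ := volume), Function.notMem_support] at ht
        simp [ht]
    have hψlim : ∀ᵐ x, Tendsto (fun m => ψ m x) atTop (𝓝 (σ x)) := by
      refine ContDiffBump.ae_convolution_tendsto_right_of_locallyIntegrable (K := 2) ?_ ?_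
        hσi.locallyIntegrable
      · exact tendsto_one_div_add_atTop_nhds_zero_nat
      · refine Eventually.of_forall fun m => ?_
        change 1 / ((m : ℝ) + 1) ≤ 2 * (1 / (2 * (m + 1)))
        apply le_of_eq
        field_simp
    have hgB : IntegrableOn g (Metric.ball (0 : Euc N) (n + 1)) :=
      (hg.integrableOn_isCompact (isCompact_closedBall 0 (n + 1))).mono_set
        Metric.ball_subset_closedBall
    have hlim : Tendsto (fun m => ∫ x, g x * ψ m x) atTop (𝓝 (∫ x, g x * σ x)) := by
      refine tendsto_integral_of_dominated_convergence
        ((Metric.ball (0 : Euc N) (n + 1)).indicator fun x => ‖g x‖) ?_ ?_ ?_ ?_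
      · exact fun m => (hgm.aestronglyMeasurable).mul (hψs m).continuous.aestronglyMeasurable
      · exact (integrable_indicator_iff measurableSet_ball).2 hgB.norm
      · refine fun m => Eventually.of_forall fun x => ?_
        by_cases hx : x ∈ Metric.ball (0 : Euc N) (n + 1)
        · rw [indicator_of_mem hx, norm_mul]
          exact mul_le_of_le_one_right (norm_nonneg _) (hψ1 m x)
        · rw [hψsupp m x hx, indicator_of_notMem hx]
          simp
      · filter_upwards [hψlim] with x hx using hx.const_mul _
    have hle : ∫ x, g x * σ x ≤ A :=
      le_of_tendsto' hlim fun m => hA _ (hψs m) (hψc m) (hψ1 m)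
    have hgσ : ∀ x, g x * σ x = B.indicator (fun x => ‖g x‖) x := by
      intro x
      by_cases hx : x ∈ B
      · simp only [σ, indicator_of_mem hx, Real.norm_eq_abs, mul_comm (g x), sign_mul_self]
      · simp [σ, indicator_of_notMem hx]
    simp only [hgσ] at hle
    rw [integral_indicator measurableSet_ball] at hle
    have hgB' : IntegrableOn g B := hgB.mono_set (Metric.ball_subset_ball (by linarith))
    rw [← ofReal_integral_norm_eq_lintegral_enorm hgB']
    exact ENNReal.ofReal_le_ofReal hle
  have hU : (⋃ n : ℕ, Metric.ball (0 : Euc N) n) = univ := Metric.iUnion_ball_nat 0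
  have hmono : Monotone fun n : ℕ => Metric.ball (0 : Euc N) n := fun a b hab =>
    Metric.ball_subset_ball (by exact_mod_cast hab)
  rw [← setLIntegral_univ, ← hU, setLIntegral_iUnion_of_directed _ hmono.directed_le]
  exact iSup_le ball_bound

/-- Translation estimate for functions of bounded variation. -/
lemma lintegral_enorm_translate_sub_le {N : ℕ} {u : Euc N → ℝ} (hu : LocallyIntegrable u)
    (hum : Measurable u) (hTV : TV N u univ ≠ ∞) (h : Euc N) :
    ∫⁻ x, ‖u (x + h) - u x‖ₑ ≤ TV N u univ * ‖h‖ₑ := by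
  have hmp : MeasurePreserving (fun x : Euc N => x + h) volume volume :=
    measurePreserving_add_right volume h
  have hut : LocallyIntegrable fun x => u (x + h) := by
    intro x
    obtain ⟨s, hs, hsi⟩ := hu (x + h)
    refine ⟨(fun x => x + h) ⁻¹' s,
      (continuous_add_const h).continuousAt.preimage_mem_nhds hs, ?_⟩
    exact (hmp.integrableOn_comp_preimage (Homeomorph.addRight h).measurableEmbedding).2 hsi
  have := lintegral_enorm_le_of_forall_test (hut.sub hu) ((hum.comp (by fun_prop)).sub hum)
    (A := (TV N u univ).toReal * ‖h‖) ?_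
  · rw [ENNReal.ofReal_mul ENNReal.toReal_nonneg, ENNReal.ofReal_toReal hTV, ofReal_norm] at this
    exact this
  intro ψ hψ hc hb
  have hi : ∀ {w : Euc N → ℝ}, LocallyIntegrable w → ∀ z, Integrable fun x => w x * ψ (x + z) := by
    intro w hw z
    refine (hw.integrable_smul_left_of_hasCompactSupport (g := fun x => ψ (x + z)) ?_ ?_).congr
      (Eventually.of_forall fun x => by simp [mul_comm])
    · exact hψ.continuous.comp (by fun_prop)
    · exact hc.comp_homeomorph (Homeomorph.addRight z)
  have e1 : ∫ x, (u (x + h) - u x) * ψ x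
      = (∫ x, u (x + h) * ψ x) - ∫ x, u x * ψ x := by
    rw [← integral_sub]
    · simp only [sub_mul]
    · simpa using hi hut 0
    · simpa using hi hu 0
  have e2 : ∫ x, u (x + h) * ψ x = ∫ x, u x * ψ (-(h - x)) := by
    rw [← integral_add_right_eq_self (fun x => u x * ψ (-(h - x))) h]
    simp
  have key := abs_convolution_sub_le_TV hu hTV (φ := fun x => ψ (-x)) (hψ.comp contDiff_neg)
    (hc.comp_homeomorph (Homeomorph.neg _)) (fun x => hb _) h
  have e3 : ∫ x, u x * ψ x = ∫ x, u x * ψ (-(0 - x)) := by simp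
  change ∫ x, (u (x + h) - u x) * ψ x ≤ _
  rw [e1, e2, e3]
  exact (le_abs_self _).trans key

/-- A smooth truncation profile. -/
lemma exists_smooth_truncation : ∃ T : ℝ → ℝ, ∃ C : ℝ, 0 ≤ C ∧ ContDiff ℝ 1 T ∧
    (∀ t, |T t| ≤ 1) ∧ (∀ t, |t| ≤ 1 → T t = 0) ∧ (∀ t, 2 ≤ |t| → T t = 1) ∧
    (∀ t, |deriv T t| ≤ C) ∧ ∀ t, ¬ (1 < |t| ∧ |t| < 2) → deriv T t = 0 := by
  set T : ℝ → ℝ := fun t => Real.smoothTransition (t ^ 2 - 2) with hT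
  have hs : ContDiff ℝ 1 T := Real.smoothTransition.contDiff.comp (by fun_prop)
  have h0 : ∀ t : ℝ, t ^ 2 ≤ 2 → T t = 0 := fun t ht =>
    Real.smoothTransition.zero_of_nonpos (by linarith)
  have h1 : ∀ t : ℝ, 3 ≤ t ^ 2 → T t = 1 := fun t ht =>
    Real.smoothTransition.one_of_one_le (by linarith)
  have hd : ∀ t, ¬ (1 < |t| ∧ |t| < 2) → deriv T t = 0 := by
    intro t ht
    rcases not_and_or.1 ht with h | h
    · have ht2 : t ^ 2 < 2 := by
        rw [← sq_abs]; nlinarith [abs_nonneg t, not_lt.1 h]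
      have : T =ᶠ[𝓝 t] fun _ => 0 := by
        filter_upwards [(continuous_pow 2).continuousAt.eventually_lt continuousAt_const ht2]
          with s hs using h0 s hs.le
      rw [this.deriv_eq]; simp
    · have ht2 : 3 < t ^ 2 := by
        rw [← sq_abs]; nlinarith [abs_nonneg t, not_lt.1 h]
      have : T =ᶠ[𝓝 t] fun _ => 1 := by
        filter_upwards [continuousAt_const.eventually_lt (continuous_pow 2).continuousAt ht2]
          with s hs using h1 s hs.le
      rw [this.deriv_eq]; simp
  obtain ⟨C, hC⟩ := (HasCompactSupport.intro (isCompact_closedBall (0 : ℝ) 2) (f := deriv T)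
    fun t ht => hd t fun h => ht (by simpa using h.2.le)).exists_bound_of_continuous
      (hs.continuous_deriv le_rfl)
  refine ⟨T, C, (norm_nonneg _).trans (hC 0), hs, fun t => ?_, fun t ht => ?_, fun t ht => ?_,
    hC, hd⟩
  · rw [abs_of_nonneg (Real.smoothTransition.nonneg _)]
    exact Real.smoothTransition.le_one _
  · exact h0 t (by rw [← sq_abs]; nlinarith [abs_nonneg t])
  · exact h1 t (by rw [← sq_abs]; nlinarith [abs_nonneg t])

lemma mul_measure_rpow_le_eLpNorm {α : Type*} [MeasurableSpace α] {μ : Measure α} {f : α → ℝ}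
    (hf : AEStronglyMeasurable f μ) {p : NNReal} (hp : 0 < p) {l : ℝ} {s : Set α}
    (hs : ∀ x ∈ s, l ≤ |f x|) :
    ENNReal.ofReal l * μ s ^ (1 / (p : ℝ)) ≤ eLpNorm f p μ := by
  have hp' : (0 : ℝ) < p := hp
  have h := mul_meas_ge_le_pow_eLpNorm' μ (p := p) (by exact_mod_cast hp.ne') (by simp) hf
    (ENNReal.ofReal l)
  have h2 : μ s ≤ μ {x | ENNReal.ofReal l ≤ ‖f x‖ₑ} := measure_mono fun x hx => by
    rw [mem_ofPred_eq, ← ofReal_norm, Real.norm_eq_abs]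
    exact ENNReal.ofReal_le_ofReal (hs x hx)
  have h3 := ENNReal.rpow_le_rpow ((mul_le_mul_right h2 _).trans h) (z := 1 / (p : ℝ))
    (by positivity)
  rwa [ENNReal.mul_rpow_of_nonneg _ _ (by positivity), ENNReal.coe_toReal, ← ENNReal.rpow_mul,
    ← ENNReal.rpow_mul, mul_one_div_cancel hp'.ne', ENNReal.rpow_one, ENNReal.rpow_one] at h3

/-- Weak Sobolev inequality on a single level, for a function with gradient in `L¹`. -/
lemma exists_level_bound (N : ℕ) {p : ℝ} (hp : (N : ℝ).HolderConjugate p) :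
    ∃ C : ℝ≥0∞, C ≠ ∞ ∧ ∀ f : Euc N → ℝ, ContDiff ℝ 1 f →
      ∀ l : ℝ, 0 < l → volume {x | l < |f x|} ≠ ∞ →
      ENNReal.ofReal l * volume {x | 2 * l < |f x|} ^ (1 / p) ≤
        C * ∫⁻ x in {x | l < |f x| ∧ |f x| < 2 * l}, ‖fderiv ℝ f x‖ₑ := by
  obtain ⟨T, C₀, hC₀, hTs, hT1, hTz, hTo, hTd, hTd0⟩ := exists_smooth_truncation
  set P : NNReal := p.toNNReal with hP
  have hPp : (P : ℝ) = p := Real.coe_toNNReal _ hp.symm.nonneg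
  have hP0 : 0 < P := by rw [← NNReal.coe_pos, hPp]; exact hp.symm.pos
  have hPc : (↑(Module.finrank ℝ (Euc N)) : NNReal).HolderConjugate P := by
    rw [finrank_euclideanSpace_fin, ← NNReal.holderConjugate_coe_iff, hPp]
    exact_mod_cast hp
  set G : NNReal := eLpNormLESNormFDerivOneConst (volume : Measure (Euc N)) P
  refine ⟨G * ENNReal.ofReal C₀, ENNReal.mul_ne_top coe_ne_top ofReal_ne_top, ?_⟩
  intro f hf l hl hfin
  let χ : ContDiffBump (0 : Euc N) := ⟨1, 2, one_pos, one_lt_two⟩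
  have hχs : ContDiff ℝ 1 χ := χ.contDiff
  obtain ⟨C₁, hC₁⟩ := (χ.hasCompactSupport.fderiv ℝ).exists_bound_of_continuous
    (hχs.continuous_fderiv one_ne_zero)
  have hC₁0 : 0 ≤ C₁ := (norm_nonneg _).trans (hC₁ 0)
  set F : Euc N → ℝ := fun x => l * T (l⁻¹ * f x) with hF
  have hFs : ContDiff ℝ 1 F := contDiff_const.mul (hTs.comp (contDiff_const.mul hf))
  have hinv : ∀ x, |l⁻¹ * f x| = l⁻¹ * |f x| := fun x => by
    rw [abs_mul, abs_of_pos (inv_pos.2 hl)]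
  have hFder : ∀ x, fderiv ℝ F x = deriv T (l⁻¹ * f x) • fderiv ℝ f x := by
    intro x
    have h1 : HasFDerivAt (fun x => l⁻¹ * f x) (l⁻¹ • fderiv ℝ f x) x :=
      (hf.differentiable one_ne_zero x).hasFDerivAt.const_mul _
    have h2 := ((hTs.differentiable one_ne_zero (l⁻¹ * f x)).hasDerivAt.comp_hasFDerivAt x h1).const_mul l
    have h3 := h2.fderiv
    change fderiv ℝ F x = _ at h3
    rw [h3, smul_smul, smul_smul]
    congr 1
    field_simp
  set S : Set (Euc N) := {x | l < |f x| ∧ |f x| < 2 * l} with hS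
  set U : Set (Euc N) := {x | l < |f x|} with hU
  have hSm : MeasurableSet S := ((isOpen_lt continuous_const hf.continuous.abs).inter
    (isOpen_lt hf.continuous.abs continuous_const)).measurableSet
  have hUm : MeasurableSet U := (isOpen_lt continuous_const hf.continuous.abs).measurableSet
  have hFd : ∀ x, ‖fderiv ℝ F x‖ₑ ≤
      S.indicator (fun x => ENNReal.ofReal C₀ * ‖fderiv ℝ f x‖ₑ) x := by
    intro x
    rw [hFder]
    by_cases hx : x ∈ S
    · rw [indicator_of_mem hx, enorm_smul]
      refine mul_le_mul_left ?_ _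
      rw [← ofReal_norm]
      exact ENNReal.ofReal_le_ofReal (hTd _)
    · rw [hTd0 _ fun h => hx ?_]
      · rw [zero_smul, ← ofReal_norm, norm_zero, ENNReal.ofReal_zero]
        exact zero_le
      · rw [hinv] at h
        constructor
        · have := mul_lt_mul_of_pos_left h.1 hl
          rwa [mul_inv_cancel_left₀ hl.ne', mul_one] at this
        · have := mul_lt_mul_of_pos_left h.2 hl
          rwa [mul_inv_cancel_left₀ hl.ne', mul_comm l 2] at this
  have hFv : ∀ x, ‖F x‖ₑ ≤ U.indicator (fun _ => ENNReal.ofReal l) x := by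
    intro x
    by_cases hx : x ∈ U
    · rw [indicator_of_mem hx, ← ofReal_norm]
      refine ENNReal.ofReal_le_ofReal ?_
      rw [hF, Real.norm_eq_abs, abs_mul, abs_of_pos hl]
      exact mul_le_of_le_one_right hl.le (hT1 _)
    · rw [hF]
      simp only
      rw [hTz _ ?_]
      · simp
      · rw [hinv, inv_mul_le_one₀ hl]
        exact not_lt.1 hx
  have main : ∀ n : ℕ, ENNReal.ofReal l *
      volume ({x | 2 * l < |f x|} ∩ Metric.ball 0 (n + 1)) ^ (1 / p) ≤
      G * (ENNReal.ofReal C₀ * (∫⁻ x in S, ‖fderiv ℝ f x‖ₑ) +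
        ENNReal.ofReal l * volume U * ENNReal.ofReal (C₁ * (1 / ((n : ℝ) + 1)))) := by
    intro n
    set r : ℝ := 1 / ((n : ℝ) + 1) with hr
    have hr0 : 0 < r := by positivity
    set X : Euc N → ℝ := fun x => χ (r • x) with hX
    have hXs : ContDiff ℝ 1 X := hχs.comp (contDiff_const_smul r)
    have hXc : HasCompactSupport X :=
      χ.hasCompactSupport.comp_homeomorph (Homeomorph.smulOfNeZero r hr0.ne')
    have hXd : ∀ x, ‖fderiv ℝ X x‖ₑ ≤ ENNReal.ofReal (C₁ * r) := by
      intro x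
      have h1 : HasFDerivAt (fun x : Euc N => r • x) (r • ContinuousLinearMap.id ℝ (Euc N)) x :=
        (hasFDerivAt_id x).const_smul r
      have h2 := ((hχs.differentiable one_ne_zero (r • x)).hasFDerivAt.comp x h1).fderiv
      change fderiv ℝ X x = _ at h2
      rw [h2, ← ofReal_norm]
      refine ENNReal.ofReal_le_ofReal ?_
      rw [ContinuousLinearMap.comp_smul, ContinuousLinearMap.comp_id, norm_smul,
        Real.norm_of_nonneg hr0.le, mul_comm]
      exact mul_le_mul_of_nonneg_right (hC₁ _) hr0.le
    have hX1 : ∀ x, ‖X x‖ₑ ≤ 1 := by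
      intro x
      rw [← ofReal_norm, ← ENNReal.ofReal_one, Real.norm_of_nonneg χ.nonneg]
      exact ENNReal.ofReal_le_ofReal χ.le_one
    have hgns := eLpNorm_le_eLpNorm_fderiv_one volume (hXs.mul hFs) hXc.mul_right hPc
    have hlow := mul_measure_rpow_le_eLpNorm (μ := volume) (l := l)
      (s := {x | 2 * l < |f x|} ∩ Metric.ball 0 (n + 1))
      (hXs.mul hFs).continuous.aestronglyMeasurable hP0 (by
        rintro x ⟨hx, hxb⟩
        change 2 * l < |f x| at hx
        have hXx : X x = 1 := by
          apply χ.one_of_mem_closedBall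
          rw [mem_closedBall_zero_iff, norm_smul, Real.norm_of_nonneg hr0.le]
          change r * ‖x‖ ≤ 1
          rw [mem_ball_zero_iff] at hxb
          rw [hr, one_div, inv_mul_le_one₀ (by positivity)]
          exact hxb.le
        have hFx : F x = l := by
          rw [hF]
          simp only
          rw [hTo _ ?_, mul_one]
          rw [hinv, le_inv_mul_iff₀ hl, mul_comm]
          exact hx.le
        change l ≤ |X x * F x|
        rw [hXx, hFx, one_mul]
        exact le_abs_self l)
    rw [hPp] at hlow
    refine (hlow.trans hgns).trans (mul_le_mul_right ?_ _)
    rw [eLpNorm_one_eq_lintegral_enorm]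
    calc ∫⁻ x, ‖fderiv ℝ (X * F) x‖ₑ
        ≤ ∫⁻ x, (S.indicator (fun x => ENNReal.ofReal C₀ * ‖fderiv ℝ f x‖ₑ) x +
            U.indicator (fun _ => ENNReal.ofReal l * ENNReal.ofReal (C₁ * r)) x) := by
          refine lintegral_mono fun x => ?_
          have h1 : fderiv ℝ (X * F) x = X x • fderiv ℝ F x + F x • fderiv ℝ X x :=
            fderiv_mul (hXs.differentiable one_ne_zero x) (hFs.differentiable one_ne_zero x)
          simp only
          rw [h1]
          have h2 : ∀ a b : Euc N →L[ℝ] ℝ, ‖a + b‖ₑ ≤ ‖a‖ₑ + ‖b‖ₑ := fun a b => by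
            simp only [← ofReal_norm]
            rw [← ENNReal.ofReal_add (norm_nonneg _) (norm_nonneg _)]
            exact ENNReal.ofReal_le_ofReal (norm_add_le a b)
          refine (h2 _ _).trans (add_le_add ?_ ?_)
          · rw [enorm_smul]
            exact (mul_le_of_le_one_left' (hX1 x)).trans (hFd x)
          · rw [enorm_smul]
            refine (mul_le_mul' (hFv x) (hXd x)).trans (le_of_eq ?_)
            by_cases hx : x ∈ U
            · simp [hx]
            · simp [hx]
      _ = _ := by
          rw [lintegral_add_right _ (measurable_const.indicator hUm),
            lintegral_indicator hSm, lintegral_indicator hUm, lintegral_const_mul]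
          · rw [setLIntegral_const]
            ring
          · exact ((hf.continuous_fderiv one_ne_zero).enorm).measurable
  have hlim1 : Tendsto (fun n : ℕ => ENNReal.ofReal l *
      volume ({x | 2 * l < |f x|} ∩ Metric.ball (0 : Euc N) (n + 1)) ^ (1 / p)) atTop
      (𝓝 (ENNReal.ofReal l * volume {x | 2 * l < |f x|} ^ (1 / p))) := by
    refine ENNReal.Tendsto.const_mul ?_ (Or.inr ofReal_ne_top)
    refine (ENNReal.continuous_rpow_const.tendsto _).comp ?_
    have hmono : Monotone fun n : ℕ =>
        {x | 2 * l < |f x|} ∩ Metric.ball (0 : Euc N) ((n : ℝ) + 1) := fun a b hab =>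
      inter_subset_inter_right _ (Metric.ball_subset_ball (by
        have : (a : ℝ) ≤ b := by exact_mod_cast hab
        linarith))
    have hU : ⋃ n : ℕ, {x | 2 * l < |f x|} ∩ Metric.ball (0 : Euc N) ((n : ℝ) + 1)
        = {x | 2 * l < |f x|} := by
      rw [← inter_iUnion, inter_eq_left]
      intro x _
      obtain ⟨n, hn⟩ := exists_nat_gt ‖x‖
      exact mem_iUnion.2 ⟨n, by rw [mem_ball_zero_iff]; linarith⟩
    have := tendsto_measure_iUnion_atTop (μ := volume) hmono
    rwa [hU] at this
  have hlim2 : Tendsto (fun n : ℕ => G * (ENNReal.ofReal C₀ * (∫⁻ x in S, ‖fderiv ℝ f x‖ₑ) +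
        ENNReal.ofReal l * volume U * ENNReal.ofReal (C₁ * (1 / ((n : ℝ) + 1))))) atTop
      (𝓝 (G * (ENNReal.ofReal C₀ * (∫⁻ x in S, ‖fderiv ℝ f x‖ₑ) +
        ENNReal.ofReal l * volume U * 0))) := by
    refine ENNReal.Tendsto.const_mul ?_ (Or.inr coe_ne_top)
    refine Tendsto.const_add _ ?_
    refine ENNReal.Tendsto.const_mul ?_ (Or.inr (ENNReal.mul_ne_top ofReal_ne_top hfin))
    rw [← ENNReal.ofReal_zero]
    refine ENNReal.tendsto_ofReal ?_
    have := (tendsto_one_div_add_atTop_nhds_zero_nat (𝕜 := ℝ)).const_mul C₁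
    rwa [mul_zero] at this
  have := le_of_tendsto_of_tendsto' hlim1 hlim2 main
  rwa [mul_zero, add_zero, ← mul_assoc] at this

/-- Summed weak Sobolev inequality over geometric levels. -/
lemma exists_tsum_level_bound_of_contDiff (N : ℕ) {p : ℝ} (hp : (N : ℝ).HolderConjugate p)
    {D : ℝ} (hD : 2 ≤ D) :
    ∃ C : ℝ≥0∞, C ≠ ∞ ∧ ∀ f : Euc N → ℝ, ContDiff ℝ 1 f →
      (∀ l : ℝ, 0 < l → volume {x | l < |f x|} ≠ ∞) →
      ∑' j : ℤ, ENNReal.ofReal (D ^ j) * volume {x | 2 * D ^ j < |f x|} ^ (1 / p) ≤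
        C * ∫⁻ x, ‖fderiv ℝ f x‖ₑ := by
  obtain ⟨C, hC, h⟩ := exists_level_bound N hp
  refine ⟨C, hC, fun f hf hfin => ?_⟩
  have hDpos : 0 < D := by linarith
  have hpos : ∀ j : ℤ, 0 < D ^ j := fun j => zpow_pos hDpos j
  calc _ ≤ ∑' j : ℤ, C * ∫⁻ x in {x | D ^ j < |f x| ∧ |f x| < 2 * D ^ j}, ‖fderiv ℝ f x‖ₑ :=
        ENNReal.tsum_le_tsum fun j => h f hf _ (hpos j) (hfin _ (hpos j))
    _ = C * ∫⁻ x in ⋃ j : ℤ, {x | D ^ j < |f x| ∧ |f x| < 2 * D ^ j}, ‖fderiv ℝ f x‖ₑ := by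
        rw [ENNReal.tsum_mul_left, lintegral_iUnion]
        · intro j
          exact ((isOpen_lt continuous_const hf.continuous.abs).inter
            (isOpen_lt hf.continuous.abs continuous_const)).measurableSet
        · refine (pairwise_disjoint_on _).2 fun i j hij => ?_
          refine disjoint_left.2 fun x hxi hxj => ?_
          have h1 : D ^ (i + 1) ≤ D ^ j := zpow_le_zpow_right₀ (by linarith) hij
          rw [zpow_add_one₀ hDpos.ne'] at h1
          have h2 := hxi.2
          have h3 := hxj.1
          nlinarith [hpos i]
    _ ≤ _ := mul_le_mul_right (setLIntegral_le_lintegral _ _) _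

lemma measure_two_mul_lt_abs_le {α : Type*} [MeasurableSpace α] {μ : Measure α} {f g : α → ℝ}
    (hf : Measurable f) (hg : Measurable g) {l : ℝ} (hl : 0 < l) :
    μ {x | 2 * l < |f x|} ≤ μ {x | l < |g x|} + (∫⁻ x, ‖f x - g x‖ₑ ∂μ) / ENNReal.ofReal l := by
  have hsub : {x | 2 * l < |f x|} ⊆
      {x | l < |g x|} ∪ {x | ENNReal.ofReal l ≤ ‖f x - g x‖ₑ} := by
    intro x hx
    change 2 * l < |f x| at hx
    by_cases h : l < |g x|
    · exact Or.inl h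
    · right
      rw [mem_ofPred_eq, ← ofReal_norm, Real.norm_eq_abs]
      refine ENNReal.ofReal_le_ofReal ?_
      have := abs_sub_abs_le_abs_sub (f x) (g x)
      linarith [not_lt.1 h]
  refine (measure_mono hsub).trans ((measure_union_le _ _).trans (add_le_add_right ?_ _))
  exact meas_ge_le_lintegral_div (hf.sub hg).enorm.aemeasurable (by simpa using hl) ofReal_ne_top

lemma lintegral_enorm_normed {N : ℕ} (φ : ContDiffBump (0 : Euc N)) :
    ∫⁻ t, ‖φ.normed volume t‖ₑ = 1 := by
  rw [← ofReal_integral_norm_eq_lintegral_enorm φ.integrable_normed]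
  simp only [Real.norm_of_nonneg (φ.nonneg_normed _)]
  rw [φ.integral_normed, ENNReal.ofReal_one]

/-- The mollification of `u` by a normed bump function. -/
abbrev mollify {N : ℕ} (φ : ContDiffBump (0 : Euc N)) (u : Euc N → ℝ) : Euc N → ℝ :=
  convolution (φ.normed volume) u (ContinuousLinearMap.lsmul ℝ ℝ) volume

lemma contDiff_mollify {N : ℕ} (φ : ContDiffBump (0 : Euc N)) {u : Euc N → ℝ}
    (hu : LocallyIntegrable u) : ContDiff ℝ 1 (mollify φ u) := by
  have : ContDiff ℝ ((1 : ℕ∞) : WithTop ℕ∞) (mollify φ u) :=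
    φ.hasCompactSupport_normed.contDiff_convolution_left _ φ.contDiff_normed hu
  exact_mod_cast this

lemma integrable_normed_mul_sub {N : ℕ} (φ : ContDiffBump (0 : Euc N)) {u : Euc N → ℝ}
    (hu : LocallyIntegrable u) (x : Euc N) :
    Integrable fun t => φ.normed volume t * u (x - t) :=
  HasCompactSupport.convolutionExists_left (ContinuousLinearMap.lsmul ℝ ℝ)
    φ.hasCompactSupport_normed (φ.contDiff_normed (n := 0)).continuous hu x

lemma lintegral_enorm_mollify_translate_sub_le {N : ℕ} (φ : ContDiffBump (0 : Euc N))
    {u : Euc N → ℝ} (hu : LocallyIntegrable u) (hum : Measurable u) (hTV : TV N u univ ≠ ∞)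
    (h : Euc N) :
    ∫⁻ x, ‖mollify φ u (x + h) - mollify φ u x‖ₑ ≤ TV N u univ * ‖h‖ₑ := by
  have hρ : Measurable (φ.normed volume) := (φ.contDiff_normed (n := 0)).continuous.measurable
  calc ∫⁻ x, ‖mollify φ u (x + h) - mollify φ u x‖ₑ
      ≤ ∫⁻ x, ∫⁻ t, ‖φ.normed volume t‖ₑ * ‖u (x - t + h) - u (x - t)‖ₑ := by
        refine lintegral_mono fun x => ?_
        have : mollify φ u (x + h) - mollify φ u x
            = ∫ t, φ.normed volume t * (u (x - t + h) - u (x - t)) := by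
          simp only [mul_sub, sub_add_eq_add_sub]
          exact (integral_sub (integrable_normed_mul_sub φ hu (x + h))
            (integrable_normed_mul_sub φ hu x)).symm
        simp only
        rw [this]
        refine (enorm_integral_le_lintegral_enorm _).trans (le_of_eq ?_)
        simp only [enorm_mul]
    _ = ∫⁻ t, ∫⁻ x, ‖φ.normed volume t‖ₑ * ‖u (x - t + h) - u (x - t)‖ₑ := by
        refine lintegral_lintegral_swap (Measurable.aemeasurable ?_)
        exact (hρ.comp measurable_snd).enorm.mul
          ((hum.comp (by fun_prop)).sub (hum.comp (by fun_prop))).enorm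
    _ ≤ ∫⁻ t, ‖φ.normed volume t‖ₑ * (TV N u univ * ‖h‖ₑ) := by
        refine lintegral_mono fun t => ?_
        simp only
        rw [lintegral_const_mul]
        · refine mul_le_mul_right ?_ _
          rw [lintegral_sub_right_eq_self (fun x => ‖u (x + h) - u x‖ₑ) t]
          exact lintegral_enorm_translate_sub_le hu hum hTV h
        · exact ((hum.comp (by fun_prop)).sub (hum.comp (by fun_prop))).enorm
    _ = _ := by
        rw [lintegral_mul_const _ hρ.enorm, lintegral_enorm_normed, one_mul]

lemma lintegral_enorm_sub_mollify_le {N : ℕ} (φ : ContDiffBump (0 : Euc N))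
    {u : Euc N → ℝ} (hu : LocallyIntegrable u) (hum : Measurable u) (hTV : TV N u univ ≠ ∞) :
    ∫⁻ x, ‖u x - mollify φ u x‖ₑ ≤ TV N u univ * ENNReal.ofReal φ.rOut := by
  have hρ : Measurable (φ.normed volume) := (φ.contDiff_normed (n := 0)).continuous.measurable
  calc ∫⁻ x, ‖u x - mollify φ u x‖ₑ
      ≤ ∫⁻ x, ∫⁻ t, ‖φ.normed volume t‖ₑ * ‖u (x - t + t) - u (x - t)‖ₑ := by
        refine lintegral_mono fun x => ?_
        have : u x - mollify φ u x
            = ∫ t, φ.normed volume t * (u (x - t + t) - u (x - t)) := by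
          simp only [mul_sub, sub_add_cancel]
          rw [integral_sub (φ.integrable_normed.mul_const _) (integrable_normed_mul_sub φ hu x),
            integral_mul_const, φ.integral_normed, one_mul]
          rfl
        simp only
        rw [this]
        refine (enorm_integral_le_lintegral_enorm _).trans (le_of_eq ?_)
        simp only [enorm_mul]
    _ = ∫⁻ t, ∫⁻ x, ‖φ.normed volume t‖ₑ * ‖u (x - t + t) - u (x - t)‖ₑ := by
        refine lintegral_lintegral_swap (Measurable.aemeasurable ?_)
        exact (hρ.comp measurable_snd).enorm.mul
          ((hum.comp (by fun_prop)).sub (hum.comp (by fun_prop))).enorm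
    _ ≤ ∫⁻ t, ‖φ.normed volume t‖ₑ * (TV N u univ * ENNReal.ofReal φ.rOut) := by
        refine lintegral_mono fun t => ?_
        simp only
        rw [lintegral_const_mul]
        · by_cases ht : t ∈ Metric.ball (0 : Euc N) φ.rOut
          · refine mul_le_mul_right ?_ _
            rw [lintegral_sub_right_eq_self (fun x => ‖u (x + t) - u x‖ₑ) t]
            refine (lintegral_enorm_translate_sub_le hu hum hTV t).trans
              (mul_le_mul_right ?_ _)
            rw [← ofReal_norm]
            exact ENNReal.ofReal_le_ofReal (mem_ball_zero_iff.1 ht).le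
          · rw [← φ.support_normed_eq (μ := volume), Function.notMem_support] at ht
            simp [ht]
        · exact ((hum.comp (by fun_prop)).sub (hum.comp (by fun_prop))).enorm
    _ = _ := by
        rw [lintegral_mul_const _ hρ.enorm, lintegral_enorm_normed, one_mul]

lemma enorm_clm_le_sum {N : ℕ} (L : Euc N →L[ℝ] ℝ) :
    ‖L‖ₑ ≤ ∑ i : Fin N, ‖L (EuclideanSpace.single i 1)‖ₑ := by
  have h : ‖L‖ ≤ ∑ i : Fin N, ‖L (EuclideanSpace.single i 1)‖ := by
    refine L.opNorm_le_bound (Finset.sum_nonneg fun i _ => norm_nonneg _) fun y => ?_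
    have h2 : y = ∑ i : Fin N, y i • EuclideanSpace.single i (1 : ℝ) := by
      ext j
      simp [Finset.sum_apply, Pi.single_apply]
    conv_lhs => rw [h2, map_sum]
    rw [Finset.sum_mul]
    refine norm_sum_le_of_le _ fun i _ => ?_
    rw [map_smul, norm_smul, mul_comm]
    exact mul_le_mul_of_nonneg_left (PiLp.norm_apply_le y i) (norm_nonneg _)
  simp only [← ofReal_norm]
  rw [← ENNReal.ofReal_sum_of_nonneg fun i _ => norm_nonneg _]
  exact ENNReal.ofReal_le_ofReal h

/-- A uniform Lipschitz bound on translations in `L¹` bounds the gradient in `L¹`. -/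
lemma lintegral_enorm_fderiv_le {N : ℕ} {f : Euc N → ℝ} (hf : ContDiff ℝ 1 f) {A : ℝ≥0∞}
    (hA : ∀ h : Euc N, ∫⁻ x, ‖f (x + h) - f x‖ₑ ≤ A * ‖h‖ₑ) :
    ∫⁻ x, ‖fderiv ℝ f x‖ₑ ≤ N * A := by
  have dir : ∀ e : Euc N, ‖e‖ = 1 → ∫⁻ x, ‖fderiv ℝ f x e‖ₑ ≤ A := by
    intro e he
    set c : ℕ → ℝ := fun n => (n : ℝ) + 1
    have hc0 : ∀ n, 0 < c n := fun n => by positivity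
    have hc : Tendsto c atTop atTop :=
      tendsto_atTop_add_const_right _ _ tendsto_natCast_atTop_atTop
    have hlim : ∀ x, Tendsto (fun n => ‖c n • (f (x + (c n)⁻¹ • e) - f x)‖ₑ) atTop
        (𝓝 ‖fderiv ℝ f x e‖ₑ) := by
      intro x
      refine (continuous_enorm.tendsto _).comp ?_
      have h1 := (hf.differentiable one_ne_zero x).hasFDerivAt
      exact h1.lim e (tendsto_norm_atTop_atTop.comp hc)
    calc ∫⁻ x, ‖fderiv ℝ f x e‖ₑ
        = ∫⁻ x, liminf (fun n => ‖c n • (f (x + (c n)⁻¹ • e) - f x)‖ₑ) atTop :=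
          lintegral_congr fun x => (hlim x).liminf_eq.symm
      _ ≤ liminf (fun n => ∫⁻ x, ‖c n • (f (x + (c n)⁻¹ • e) - f x)‖ₑ) atTop := by
          refine lintegral_liminf_le fun n => ?_
          have := hf.continuous
          exact (by fun_prop : Continuous fun x => c n • (f (x + (c n)⁻¹ • e) - f x)).enorm.measurable
      _ ≤ A := by
          refine (liminf_le_liminf (v := fun _ => A) (Eventually.of_forall fun n => ?_)).trans
            (by simp)
          simp only [enorm_smul]
          rw [lintegral_const_mul]
          · refine (mul_le_mul_right (hA _) _).trans ?_
            rw [enorm_smul, ← ofReal_norm e, he, ENNReal.ofReal_one, mul_one, mul_comm A,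
              ← mul_assoc, ← enorm_mul, mul_inv_cancel₀ (hc0 n).ne']
            simp
          · have := hf.continuous
            exact (by fun_prop : Continuous fun x => f (x + (c n)⁻¹ • e) - f x).enorm.measurable
  have hm : ∀ e : Euc N, Measurable fun x => ‖fderiv ℝ f x e‖ₑ := fun e =>
    ((hf.continuous_fderiv one_ne_zero).clm_apply continuous_const).enorm.measurable
  calc ∫⁻ x, ‖fderiv ℝ f x‖ₑ
      ≤ ∫⁻ x, ∑ i : Fin N, ‖fderiv ℝ f x (EuclideanSpace.single i 1)‖ₑ :=
        lintegral_mono fun x => enorm_clm_le_sum _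
    _ = ∑ i : Fin N, ∫⁻ x, ‖fderiv ℝ f x (EuclideanSpace.single i 1)‖ₑ :=
        lintegral_finsetSum _ fun i _ => hm _
    _ ≤ ∑ _i : Fin N, A := Finset.sum_le_sum fun i _ => dir _ (by simp)
    _ = N * A := by simp

/-- The embedding of `BV̇` into `L^{1*,1}`, in terms of geometric levels. -/
lemma exists_tsum_level_bound (N : ℕ) {p : ℝ} (hp : (N : ℝ).HolderConjugate p)
    {D : ℝ} (hD : 2 ≤ D) :
    ∃ C : ℝ≥0∞, C ≠ ∞ ∧ ∀ u : Euc N → ℝ, LocallyIntegrable u → MemBVdot N u →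
      ∑' j : ℤ, ENNReal.ofReal (D ^ j) * volume {x | D ^ j < |u x|} ^ (1 / p) ≤
        C * TV N u univ := by
  obtain ⟨C, hC, h⟩ := exists_tsum_level_bound_of_contDiff N hp hD
  refine ⟨ENNReal.ofReal (D ^ (2 : ℤ)) * (C * N),
    ENNReal.mul_ne_top ofReal_ne_top (ENNReal.mul_ne_top hC (by simp)), ?_⟩
  rintro u hu ⟨hum, huv, huTV⟩
  have hDpos : 0 < D := by linarith
  have hpos : ∀ j : ℤ, 0 < D ^ j := fun j => zpow_pos hDpos j
  have hp1 : 1 / p ≤ 1 := by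
    rw [div_le_one hp.symm.pos]; exact hp.symm.lt.le
  have hp0 : 0 ≤ 1 / p := by have := hp.symm.pos; positivity
  have hTV := huTV.ne
  let φ : ℕ → ContDiffBump (0 : Euc N) := fun m =>
    ⟨1 / (2 * (m + 1)), 1 / (m + 1), by positivity, by
      apply one_div_lt_one_div_of_lt <;> nlinarith [(m.cast_nonneg : (0:ℝ) ≤ m)]⟩
  have hwm : ∀ n, Measurable (mollify (φ n) u) := fun n =>
    (contDiff_mollify (φ n) hu).continuous.measurable
  have hcl := fun n => lintegral_enorm_sub_mollify_le (φ n) hu hum hTV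
  have hfin : ∀ n, ∀ l : ℝ, 0 < l → volume {x | l < |mollify (φ n) u x|} ≠ ∞ := by
    intro n l hl
    have h1 := measure_two_mul_lt_abs_le (μ := volume) (hwm n) hum (half_pos hl)
    rw [mul_div_cancel₀ l two_ne_zero] at h1
    refine ne_top_of_le_ne_top (ENNReal.add_ne_top.2 ⟨(huv _ (half_pos hl)).ne,
      ENNReal.div_ne_top ?_ (by simpa using hl)⟩) h1
    simp only [enorm_sub_rev _ (u _)]
    exact ne_top_of_le_ne_top (ENNReal.mul_ne_top hTV ofReal_ne_top) (hcl n)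
  set E : ℕ → ℤ → ℝ≥0∞ := fun n j =>
    (TV N u univ * ENNReal.ofReal (1 / ((n : ℝ) + 1))) / ENNReal.ofReal (2 * D ^ j) with hE
  have fin_bound : ∀ J : Finset ℤ,
      ∑ j ∈ J, ENNReal.ofReal (D ^ j) * volume {x | 2 * (2 * D ^ j) < |u x|} ^ (1 / p) ≤
        C * (N * TV N u univ) := by
    intro J
    have step : ∀ n : ℕ,
        ∑ j ∈ J, ENNReal.ofReal (D ^ j) * volume {x | 2 * (2 * D ^ j) < |u x|} ^ (1 / p) ≤
        C * (N * TV N u univ) + ∑ j ∈ J, ENNReal.ofReal (D ^ j) * E n j ^ (1 / p) := by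
      intro n
      have h1 : ∑ j ∈ J, ENNReal.ofReal (D ^ j) *
          volume {x | 2 * D ^ j < |mollify (φ n) u x|} ^ (1 / p) ≤ C * (N * TV N u univ) :=
        (ENNReal.sum_le_tsum J).trans ((h _ (contDiff_mollify (φ n) hu) (hfin n)).trans
          (mul_le_mul_right (lintegral_enorm_fderiv_le (contDiff_mollify (φ n) hu)
            (lintegral_enorm_mollify_translate_sub_le (φ n) hu hum hTV)) _))
      refine le_trans ?_ (add_le_add_left h1 _)
      rw [← Finset.sum_add_distrib]
      refine Finset.sum_le_sum fun j _ => ?_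
      rw [← mul_add]
      refine mul_le_mul_right ?_ _
      refine (ENNReal.rpow_le_rpow ?_ hp0).trans (ENNReal.rpow_add_le_add_rpow _ _ hp0 hp1)
      refine (measure_two_mul_lt_abs_le hum (hwm n) (by have := hpos j; positivity)).trans
        (add_le_add_right ?_ _)
      exact ENNReal.div_le_div_right (hcl n) _
    have hlim : Tendsto (fun n : ℕ => C * (N * TV N u univ) +
        ∑ j ∈ J, ENNReal.ofReal (D ^ j) * E n j ^ (1 / p)) atTop
        (𝓝 (C * (N * TV N u univ) + ∑ _j ∈ J, 0)) := by
      refine Tendsto.const_add _ (tendsto_finsetSum _ fun j _ => ?_)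
      have h0 : Tendsto (fun n : ℕ => ENNReal.ofReal (1 / ((n : ℝ) + 1))) atTop (𝓝 0) := by
        rw [← ENNReal.ofReal_zero]
        exact ENNReal.tendsto_ofReal tendsto_one_div_add_atTop_nhds_zero_nat
      have h1 : Tendsto (fun n => E n j) atTop (𝓝 0) := by
        have := ENNReal.Tendsto.div_const (ENNReal.Tendsto.const_mul h0 (Or.inr hTV))
          (b := ENNReal.ofReal (2 * D ^ j)) (Or.inr (by have := hpos j; simpa using this))
        rwa [mul_zero, ENNReal.zero_div] at this
      have h2 := ENNReal.Tendsto.const_mul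
        (((ENNReal.continuous_rpow_const (y := 1 / p)).tendsto _).comp h1)
        (a := ENNReal.ofReal (D ^ j)) (Or.inr ofReal_ne_top)
      rwa [ENNReal.zero_rpow_of_pos (by have := hp.symm.pos; positivity), mul_zero] at h2
    rw [Finset.sum_const_zero, add_zero] at hlim
    exact ge_of_tendsto' hlim step
  rw [← (Equiv.addRight (2 : ℤ)).tsum_eq]
  calc _ ≤ ∑' j : ℤ, ENNReal.ofReal (D ^ (2 : ℤ)) * (ENNReal.ofReal (D ^ j) *
          volume {x | 2 * (2 * D ^ j) < |u x|} ^ (1 / p)) := by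
        refine ENNReal.tsum_le_tsum fun j => ?_
        have e : D ^ (j + 2) = D ^ (2 : ℤ) * D ^ j := by
          rw [zpow_add₀ hDpos.ne', mul_comm]
        have hD2 : (4 : ℝ) ≤ D ^ (2 : ℤ) := by
          rw [show (D ^ (2 : ℤ)) = D ^ 2 by norm_cast]
          nlinarith
        rw [Equiv.coe_addRight, e, ENNReal.ofReal_mul (by positivity), mul_assoc]
        refine mul_le_mul_right (mul_le_mul_right (ENNReal.rpow_le_rpow ?_ hp0) _) _
        refine measure_mono fun x hx => ?_
        refine lt_of_le_of_lt ?_ (show D ^ (2 : ℤ) * D ^ j < |u x| from hx)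
        nlinarith [hpos j]
    _ ≤ ENNReal.ofReal (D ^ (2 : ℤ)) * (C * (N * TV N u univ)) := by
        rw [ENNReal.tsum_mul_left]
        refine mul_le_mul_right ?_ _
        rw [ENNReal.tsum_eq_iSup_sum]
        exact iSup_le fin_bound
    _ = _ := by ring

lemma lintegral_rpow_sub_one_le {a : ℝ} (ha : 0 < a) (m : ℝ≥0∞) :
    ∫⁻ t in Ioi (0 : ℝ) ∩ {t | ENNReal.ofReal t < m}, ENNReal.ofReal (t ^ (a - 1)) ≤
      ENNReal.ofReal a⁻¹ * m ^ a := by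
  rcases eq_or_ne m ∞ with rfl | hm
  · rw [ENNReal.top_rpow_of_pos ha, ENNReal.mul_top (by simpa using ha)]
    exact le_top
  have hsub : Ioi (0 : ℝ) ∩ {t | ENNReal.ofReal t < m} ⊆ Ioc 0 m.toReal := fun t ht =>
    ⟨ht.1, ((ENNReal.ofReal_lt_iff_lt_toReal (le_of_lt ht.1) hm).1 ht.2).le⟩
  have hintg : IntegrableOn (fun t : ℝ => t ^ (a - 1)) (Ioc 0 m.toReal) :=
    (intervalIntegrable_iff_integrableOn_Ioc_of_le ENNReal.toReal_nonneg).1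
      (intervalIntegral.intervalIntegrable_rpow' (by linarith))
  refine (lintegral_mono_set hsub).trans ?_
  rw [← ofReal_integral_eq_lintegral_ofReal hintg
    ((ae_restrict_iff' measurableSet_Ioc).2 (Eventually.of_forall fun t ht =>
      Real.rpow_nonneg ht.1.le _)),
    ← intervalIntegral.integral_of_le ENNReal.toReal_nonneg,
    integral_rpow (Or.inl (by linarith)), sub_add_cancel, Real.zero_rpow ha.ne', sub_zero,
    div_eq_inv_mul, ENNReal.ofReal_mul (inv_nonneg.2 ha.le),
    ← ENNReal.ofReal_rpow_of_nonneg ENNReal.toReal_nonneg ha.le, ENNReal.ofReal_toReal hm]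

/-- The Lorentz quasinorm is controlled by the distribution function on geometric levels. -/
lemma lorentz_le_tsum_levels (N : ℕ) {p q D : ℝ} (hp : 0 < p) (hq : 0 < q) (hD : 1 < D)
    {u : Euc N → ℝ} :
    lorentz N p (ENNReal.ofReal q) u ≤
      (ENNReal.ofReal (D ^ q) * ENNReal.ofReal (q / p)⁻¹ *
        ∑' j : ℤ, (ENNReal.ofReal (D ^ j) * volume {x | D ^ j < |u x|} ^ (1 / p)) ^ q)
          ^ (1 / q) := by
  have hDpos : 0 < D := by linarith
  have hpos : ∀ j : ℤ, 0 < D ^ j := fun j => zpow_pos hDpos j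
  have ha : 0 < q / p := div_pos hq hp
  rw [lorentz, if_neg ofReal_ne_top, ENNReal.toReal_ofReal hq.le]
  refine ENNReal.rpow_le_rpow ?_ (by positivity)
  set A : ℤ → Set ℝ := fun j => {t | ENNReal.ofReal t < volume {x | D ^ j < |u x|}} with hA
  have hAm : ∀ j, MeasurableSet (A j) := fun j =>
    measurableSet_lt ENNReal.measurable_ofReal measurable_const
  have hmeas : Measurable fun t : ℝ => ENNReal.ofReal (t ^ (q / p - 1)) := by fun_prop
  calc ∫⁻ t in Ioi (0 : ℝ), ENNReal.ofReal ((t ^ (1 / p) * rearr N u t) ^ q / t)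
      ≤ ∫⁻ t in Ioi (0 : ℝ), ∑' j : ℤ, ENNReal.ofReal ((D ^ (j + 1)) ^ q) *
          (A j).indicator (fun t => ENNReal.ofReal (t ^ (q / p - 1))) t := by
        refine setLIntegral_mono' measurableSet_Ioi fun t ht => ?_
        have ht0 : 0 < t := ht
        have hbdd : BddBelow {l : ℝ | 0 < l ∧ volume {x : Euc N | l < |u x|} ≤ ENNReal.ofReal t} :=
          ⟨0, fun l hl => hl.1.le⟩
        have hr0 : 0 ≤ rearr N u t := Real.sInf_nonneg fun l hl => hl.1.le
        rcases hr0.eq_or_lt with h | h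
        · rw [← h, mul_zero, Real.zero_rpow hq.ne', zero_div, ENNReal.ofReal_zero]
          exact zero_le
        obtain ⟨j, hj1, hj2⟩ := exists_mem_Ioc_zpow h hD
        have htA : t ∈ A j := by
          by_contra hcon
          exact absurd (csInf_le hbdd ⟨hpos j, not_lt.1 hcon⟩) (not_le.2 hj1)
        refine le_trans ?_ (ENNReal.le_tsum j)
        rw [indicator_of_mem htA, ← ENNReal.ofReal_mul (by have := hpos (j + 1); positivity)]
        refine ENNReal.ofReal_le_ofReal ?_
        rw [Real.mul_rpow (by positivity) hr0, ← Real.rpow_mul ht0.le, Real.rpow_sub_one ht0.ne',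
          one_div_mul_eq_div, mul_comm, mul_div_assoc]
        exact mul_le_mul_of_nonneg_right (Real.rpow_le_rpow hr0 hj2 hq.le) (by positivity)
    _ = ∑' j : ℤ, ENNReal.ofReal ((D ^ (j + 1)) ^ q) *
          ∫⁻ t in Ioi (0 : ℝ) ∩ A j, ENNReal.ofReal (t ^ (q / p - 1)) := by
        rw [lintegral_tsum fun j =>
          ((hmeas.indicator (hAm j)).const_mul _).aemeasurable]
        refine tsum_congr fun j => ?_
        rw [lintegral_const_mul _ (hmeas.indicator (hAm j)), lintegral_indicator (hAm j),
          Measure.restrict_restrict (hAm j), inter_comm]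
    _ ≤ ∑' j : ℤ, ENNReal.ofReal ((D ^ (j + 1)) ^ q) *
          (ENNReal.ofReal (q / p)⁻¹ * volume {x | D ^ j < |u x|} ^ (q / p)) :=
        ENNReal.tsum_le_tsum fun j => mul_le_mul_right (lintegral_rpow_sub_one_le ha _) _
    _ = _ := by
        rw [← ENNReal.tsum_mul_left]
        refine tsum_congr fun j => ?_
        rw [ENNReal.mul_rpow_of_nonneg _ _ hq.le, ← ENNReal.rpow_mul, one_div_mul_eq_div,
          zpow_add_one₀ hDpos.ne', Real.mul_rpow (hpos j).le hDpos.le,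
          ENNReal.ofReal_mul (by have := hpos j; positivity),
          ENNReal.ofReal_rpow_of_nonneg (hpos j).le hq.le]
        ring

lemma tsum_rpow_le_of_le {ι : Type*} {b : ι → ℝ≥0∞} {d : ℝ≥0∞} {q : ℝ} (hq : 1 < q)
    (hb : ∀ j, b j ≤ d) (hbt : ∑' j, b j ≠ ∞) :
    ∑' j, b j ^ q ≤ d ^ (q - 1) * ∑' j, b j := by
  rw [← ENNReal.tsum_mul_left]
  refine ENNReal.tsum_le_tsum fun j => ?_
  have h : b j ^ q = b j ^ (q - 1) * b j := by
    rcases eq_or_ne (b j) 0 with h0 | h0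
    · rw [h0, ENNReal.zero_rpow_of_pos (by linarith), mul_zero]
    · nth_rewrite 3 [← ENNReal.rpow_one (b j)]
      rw [← ENNReal.rpow_add _ _ h0 (ENNReal.ne_top_of_tsum_ne_top hbt j), sub_add_cancel]
  rw [h]
  exact mul_le_mul_left (ENNReal.rpow_le_rpow (hb j) (by linarith)) _

/-- If the averages of `|u|` over balls of radius `s` are at most `l`, then the level set of height
`2 * l` is small. -/
lemma measure_level_le_of_averages_le {N : ℕ} {u : Euc N → ℝ} (hu : LocallyIntegrable u)
    (hum : Measurable u) (hTV : TV N u univ ≠ ∞) {s l : ℝ} (hs : 0 < s) (hl : 0 < l)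
    (h : ∀ z : Euc N, ∫⁻ x in Metric.ball z s, ‖u x‖ₑ ≤
      ENNReal.ofReal l * volume (Metric.ball (0 : Euc N) s)) :
    volume {x | 2 * l < |u x|} ≤ TV N u univ * ENNReal.ofReal s / ENNReal.ofReal l := by
  set B := Metric.ball (0 : Euc N) s
  set V := volume B
  have hV0 : V ≠ 0 := (Metric.measure_ball_pos volume _ hs).ne'
  have hVt : V ≠ ∞ := measure_ball_lt_top.ne
  have hl0 : ENNReal.ofReal l ≠ 0 := by simpa using hl
  set H : Euc N → ℝ≥0∞ := fun x => ∫⁻ y in B, ‖u x - u (x - y)‖ₑ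
  have hjm : Measurable fun z : Euc N × Euc N => ‖u z.1 - u (z.1 - z.2)‖ₑ :=
    ((hum.comp measurable_fst).sub (hum.comp (by fun_prop))).enorm
  have hHm : Measurable H := hjm.lintegral_prod_right'
  have avg : ∀ x, ∫⁻ y in B, ‖u (x - y)‖ₑ ≤ ENNReal.ofReal l * V := by
    intro x
    refine le_trans (le_of_eq ?_) (h x)
    rw [← lintegral_indicator measurableSet_ball, ← lintegral_indicator measurableSet_ball,
      ← lintegral_sub_left_eq_self ((Metric.ball x s).indicator fun y => ‖u y‖ₑ) x]
    refine lintegral_congr fun y => ?_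
    have : y ∈ B ↔ x - y ∈ Metric.ball x s := by
      simp [B, dist_eq_norm]
    by_cases hy : y ∈ B
    · rw [indicator_of_mem hy, indicator_of_mem (this.1 hy)]
    · rw [indicator_of_notMem hy, indicator_of_notMem (mt this.2 hy)]
  have sub : {x | 2 * l < |u x|} ⊆ {x | ENNReal.ofReal l * V ≤ H x} := by
    intro x hx
    change 2 * l < |u x| at hx
    have h1 : ENNReal.ofReal (2 * l) * V ≤ H x + ENNReal.ofReal l * V := by
      calc ENNReal.ofReal (2 * l) * V ≤ ‖u x‖ₑ * V := by
            refine mul_le_mul_left ?_ _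
            rw [← ofReal_norm]
            exact ENNReal.ofReal_le_ofReal hx.le
        _ = ∫⁻ y in B, ‖u x‖ₑ := (setLIntegral_const _ _).symm
        _ ≤ ∫⁻ y in B, (‖u x - u (x - y)‖ₑ + ‖u (x - y)‖ₑ) := by
            refine lintegral_mono fun y => ?_
            simpa using enorm_add_le (u x - u (x - y)) (u (x - y))
        _ = H x + ∫⁻ y in B, ‖u (x - y)‖ₑ :=
            lintegral_add_right _ (hum.comp (by fun_prop)).enorm
        _ ≤ _ := add_le_add_right (avg x) _
    rw [two_mul, ENNReal.ofReal_add hl.le hl.le, add_mul] at h1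
    exact (ENNReal.add_le_add_iff_right (ENNReal.mul_ne_top ofReal_ne_top hVt)).1 h1
  have total : ∫⁻ x, H x ≤ TV N u univ * ENNReal.ofReal s * V := by
    calc ∫⁻ x, H x = ∫⁻ y in B, ∫⁻ x, ‖u x - u (x - y)‖ₑ :=
          lintegral_lintegral_swap hjm.aemeasurable
      _ ≤ ∫⁻ _y in B, TV N u univ * ENNReal.ofReal s := by
          refine setLIntegral_mono' measurableSet_ball fun y hy => ?_
          have e := lintegral_sub_right_eq_self (μ := volume) (fun x => ‖u (x + y) - u x‖ₑ) y
          simp only [sub_add_cancel] at e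
          rw [e]
          refine (lintegral_enorm_translate_sub_le hu hum hTV y).trans (mul_le_mul_right ?_ _)
          rw [← ofReal_norm]
          exact ENNReal.ofReal_le_ofReal (mem_ball_zero_iff.1 hy).le
      _ = _ := setLIntegral_const _ _
  calc volume {x | 2 * l < |u x|} ≤ volume {x | ENNReal.ofReal l * V ≤ H x} := measure_mono sub
    _ ≤ (∫⁻ x, H x) / (ENNReal.ofReal l * V) :=
        meas_ge_le_lintegral_div hHm.aemeasurable (mul_ne_zero hl0 hV0)
          (ENNReal.mul_ne_top ofReal_ne_top hVt)
    _ ≤ TV N u univ * ENNReal.ofReal s * V / (ENNReal.ofReal l * V) :=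
        ENNReal.div_le_div_right total _
    _ = _ := ENNReal.mul_div_mul_right _ _ hV0 hVt

/-- A function that fails to be locally integrable has translates with arbitrarily large integral
over any given bounded set of positive measure. -/
lemma exists_translate_lt_setLIntegral {N : ℕ} {w : Euc N → ℝ} (hw : Measurable w)
    (hn : ¬ LocallyIntegrable w) {A : Set (Euc N)} (hA : IsCompact A) (hA0 : volume A ≠ 0)
    {c : ℝ≥0∞} (hc : c ≠ ∞) : ∃ y, c < ∫⁻ x in A, ‖w (x - y)‖ₑ := by
  by_contra! hcon
  obtain ⟨x₀, hx₀⟩ : ∃ x₀, ∫⁻ x in Metric.ball x₀ 1, ‖w x‖ₑ = ∞ := by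
    by_contra! hfin
    exact hn fun x => ⟨Metric.ball x 1, Metric.ball_mem_nhds x one_pos,
      hw.aestronglyMeasurable, (hfin x).lt_top⟩
  obtain ⟨R, hR⟩ := hA.isBounded.subset_closedBall (0 : Euc N)
  set B := Metric.ball (-x₀) (R + 1)
  have hjm : Measurable fun z : Euc N × Euc N => ‖w (z.2 - z.1)‖ₑ :=
    (hw.comp (by fun_prop)).enorm
  have h1 : ∫⁻ y in B, ∫⁻ x in A, ‖w (x - y)‖ₑ ≤ c * volume B :=
    (lintegral_mono fun y => hcon y).trans (le_of_eq (setLIntegral_const _ _))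
  have h2 : ∫⁻ y in B, ∫⁻ x in A, ‖w (x - y)‖ₑ = ∞ := by
    rw [lintegral_lintegral_swap hjm.aemeasurable]
    refine eq_top_iff.2 ?_
    calc ∞ = ∫⁻ _x in A, ∞ := by rw [setLIntegral_const, ENNReal.top_mul hA0]
      _ ≤ _ := by
        refine setLIntegral_mono' hA.measurableSet fun x hx => ?_
        rw [← hx₀, ← lintegral_indicator measurableSet_ball,
          ← lintegral_indicator measurableSet_ball, ← lintegral_sub_left_eq_self _ x]
        refine lintegral_mono fun y => ?_
        by_cases hy : x - y ∈ Metric.ball x₀ 1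
        · have hyB : y ∈ B := by
            have hx' := mem_closedBall_zero_iff.1 (hR hx)
            rw [mem_ball_iff_norm] at hy ⊢
            calc ‖y - -x₀‖ = ‖x - (x - y - x₀)‖ := by congr 1; abel
              _ ≤ ‖x‖ + ‖x - y - x₀‖ := norm_sub_le _ _
              _ < R + 1 := by linarith
          rw [indicator_of_mem hy, indicator_of_mem hyB]
        · rw [indicator_of_notMem hy]
          exact zero_le
  rw [h2] at h1
  exact absurd h1 (not_le.2 (ENNReal.mul_lt_top hc.lt_top measure_ball_lt_top))

lemma exists_translate_compact_subset {N : ℕ} {w : Euc N → ℝ} (hw : Measurable w)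
    (hn : ¬ LocallyIntegrable w) {A : Set (Euc N)} (hA : IsCompact A) (hA0 : volume A ≠ 0)
    {d : ℝ≥0∞} (hd : d ≠ 0) : ∃ y, ∃ A' ⊆ A, IsCompact A' ∧ volume (A \ A') ≤ d ∧
      (∃ M : ℕ, ∀ x ∈ A', ‖w (x - y)‖ₑ ≤ M) ∧ 2 ≤ ∫⁻ x in A', ‖w (x - y)‖ₑ := by
  obtain ⟨y, hy⟩ := exists_translate_lt_setLIntegral hw hn hA hA0 (c := 3) (by simp)
  set g : Euc N → ℝ≥0∞ := fun x => ‖w (x - y)‖ₑ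
  have hg : Measurable g := (hw.comp (by fun_prop)).enorm
  set S : ℕ → Set (Euc N) := fun M => A ∩ {x | g x ≤ M}
  have hSm : ∀ M, MeasurableSet (S M) := fun M =>
    hA.measurableSet.inter (measurableSet_le hg measurable_const)
  have hSmono : Monotone S := fun a b hab x hx =>
    ⟨hx.1, (show g x ≤ a from hx.2).trans (by exact_mod_cast hab)⟩
  have hSU : ⋃ M, S M = A := by
    rw [← inter_iUnion, inter_eq_left]
    intro x _
    obtain ⟨n, hn⟩ := ENNReal.exists_nat_gt (show g x ≠ ∞ from enorm_ne_top)
    exact mem_iUnion.2 ⟨n, hn.le⟩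
  have hAt : volume A ≠ ∞ := hA.measure_lt_top.ne
  have hd2 : d / 2 ≠ 0 := by simpa using hd
  have ev1 : ∀ᶠ M in atTop, 3 < ∫⁻ x in S M, g x := by
    have h : ∫⁻ x in A, g x = ⨆ M, ∫⁻ x in S M, g x := by
      rw [← setLIntegral_iUnion_of_directed _ hSmono.directed_le, hSU]
    have hlim : Tendsto (fun M => ∫⁻ x in S M, g x) atTop (𝓝 (∫⁻ x in A, g x)) := by
      rw [h]
      exact tendsto_atTop_iSup fun a b hab => lintegral_mono_set (hSmono hab)
    exact hlim.eventually (lt_mem_nhds hy)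
  have ev2 : ∀ᶠ M in atTop, volume (A \ S M) < d / 2 := by
    have hlim := tendsto_measure_iInter_atTop (μ := volume) (s := fun M => A \ S M)
      (fun M => (hA.measurableSet.diff (hSm M)).nullMeasurableSet)
      (fun a b hab => sdiff_subset_sdiff_right (hSmono hab))
      ⟨0, measure_ne_top_of_subset sdiff_subset hAt⟩
    rw [← sdiff_iUnion, hSU, sdiff_self, measure_empty] at hlim
    exact hlim.eventually (gt_mem_nhds (pos_iff_ne_zero.2 hd2))
  obtain ⟨M, hM1, hM2⟩ := (ev1.and ev2).exists
  have hMpos : ((M : ℝ≥0∞) + 1)⁻¹ ≠ 0 := by simp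
  obtain ⟨K, hKS, hK, hKd⟩ := (hSm M).exists_isCompact_sdiff_lt (μ := volume)
    (measure_ne_top_of_subset inter_subset_left hAt)
    (show min (d / 2) ((M : ℝ≥0∞) + 1)⁻¹ ≠ 0 from (lt_min (pos_iff_ne_zero.2 hd2)
      (pos_iff_ne_zero.2 hMpos)).ne')
  refine ⟨y, K, hKS.trans inter_subset_left, hK, ?_, ⟨M, fun x hx => (hKS hx).2⟩, ?_⟩
  · calc volume (A \ K) ≤ volume ((A \ S M) ∪ (S M \ K)) := by
          refine measure_mono fun x hx => ?_
          by_cases h : x ∈ S M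
          · exact Or.inr ⟨h, hx.2⟩
          · exact Or.inl ⟨hx.1, h⟩
      _ ≤ d / 2 + d / 2 := (measure_union_le _ _).trans
          (add_le_add hM2.le (hKd.le.trans (min_le_left _ _)))
      _ = d := ENNReal.add_halves d
  · have h1 : ∫⁻ x in S M \ K, g x ≤ 1 := by
      calc ∫⁻ x in S M \ K, g x ≤ ∫⁻ _x in S M \ K, (M : ℝ≥0∞) :=
            setLIntegral_mono' ((hSm M).diff hK.measurableSet) fun x hx => hx.1.2
        _ = M * volume (S M \ K) := setLIntegral_const _ _
        _ ≤ (M + 1) * ((M : ℝ≥0∞) + 1)⁻¹ :=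
            mul_le_mul' le_self_add (hKd.le.trans (min_le_right _ _))
        _ ≤ 1 := ENNReal.mul_inv_le_one _
    have h2 : ∫⁻ x in S M, g x = (∫⁻ x in K, g x) + ∫⁻ x in S M \ K, g x := by
      rw [← lintegral_inter_add_sdiff g (S M) hK.measurableSet, inter_eq_right.2 hKS]
    have h3 : (2 : ℝ≥0∞) + 1 ≤ (∫⁻ x in K, g x) + 1 := by
      calc (2 : ℝ≥0∞) + 1 = 3 := by norm_num
        _ ≤ ∫⁻ x in S M, g x := hM1.le
        _ ≤ _ := h2 ▸ add_le_add_right h1 _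
    exact (ENNReal.add_le_add_iff_right one_ne_top).1 h3

lemma measure_sdiff_iInter_le {α : Type*} [MeasurableSpace α] {μ : Measure α} {K : ℕ → Set α}
    {d : ℕ → ℝ≥0∞} (hK : ∀ n, μ (K n \ K (n + 1)) ≤ d n) (hd : ∀ n, d (n + 1) ≤ d n / 2)
    (hsub : ∀ n, K (n + 1) ⊆ K n) (m : ℕ) : μ (K m \ ⋂ n, K n) ≤ 2 * d m := by
  have hdm : ∀ i, d (m + i) ≤ d m * 2⁻¹ ^ i := by
    intro i
    induction i with
    | zero => simp
    | succ i ih =>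
      calc d (m + (i + 1)) ≤ d (m + i) / 2 := hd _
        _ ≤ d m * 2⁻¹ ^ i / 2 := ENNReal.div_le_div_right ih _
        _ = d m * 2⁻¹ ^ (i + 1) := by rw [div_eq_mul_inv, mul_assoc, pow_succ]
  have hcov : K m \ ⋂ n, K n ⊆ ⋃ i, K (m + i) \ K (m + i + 1) := by
    rintro x ⟨hx, hx'⟩
    by_contra hcon
    simp only [mem_iUnion, Set.mem_sdiff, not_exists, not_and, not_not] at hcon
    have hall : ∀ i, x ∈ K (m + i) := by
      intro i
      induction i with
      | zero => simpa using hx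
      | succ i ih => exact hcon i ih
    refine hx' (mem_iInter.2 fun n => ?_)
    exact antitone_nat_of_succ_le hsub (Nat.le_add_left n m) (hall n)
  calc μ (K m \ ⋂ n, K n) ≤ ∑' i, μ (K (m + i) \ K (m + i + 1)) :=
        (measure_mono hcov).trans (measure_iUnion_le _)
    _ ≤ ∑' i, d m * 2⁻¹ ^ i := ENNReal.tsum_le_tsum fun i => (hK _).trans (hdm i)
    _ = 2 * d m := by
        rw [ENNReal.tsum_mul_left, ENNReal.tsum_geometric, ENNReal.one_sub_inv_two, inv_inv,
          mul_comm]

/-- A sequence of functions none of which is locally integrable admits translates that are all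
integrable, with integral bounded below, on a common compact set. -/
lemma exists_translates_integrableOn_compact {N : ℕ} {w : ℕ → Euc N → ℝ}
    (hw : ∀ n, Measurable (w n)) (hn : ∀ n, ¬ LocallyIntegrable (w n)) :
    ∃ y : ℕ → Euc N, ∃ K : Set (Euc N), IsCompact K ∧
      ∀ n, 1 ≤ ∫ x in K, |w n (x - y n)| := by
  let State := {s : Set (Euc N) × ℝ≥0∞ // IsCompact s.1 ∧ volume s.1 ≠ 0 ∧ s.2 ≠ 0}
  have step : ∀ (n : ℕ) (s : State), ∃ (s' : State) (y : Euc N),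
      s'.1.1 ⊆ s.1.1 ∧ volume (s.1.1 \ s'.1.1) ≤ s.1.2 ∧ s'.1.2 ≤ s.1.2 / 2 ∧
      2 ≤ (∫⁻ x in s'.1.1, ‖w n (x - y)‖ₑ) ∧
      ∃ M : ℕ, (∀ x ∈ s'.1.1, ‖w n (x - y)‖ₑ ≤ M) ∧ M * (2 * s'.1.2) ≤ 1 := by
    rintro n ⟨⟨A, d⟩, hA, hA0, hd⟩
    obtain ⟨y, A', hAA, hA', hvol, ⟨M, hM⟩, h2⟩ :=
      exists_translate_compact_subset (hw n) (hn n) hA hA0 hd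
    have hA'0 : volume A' ≠ 0 := by
      intro h0
      rw [setLIntegral_measure_zero _ _ h0] at h2
      simp at h2
    have hd' : min (d / 2) (2 * ((M : ℝ≥0∞) + 1))⁻¹ ≠ 0 :=
      (lt_min (pos_iff_ne_zero.2 (by simpa using hd)) (pos_iff_ne_zero.2
        (ENNReal.inv_ne_zero.2 (ENNReal.mul_ne_top (by simp) (by simp))))).ne'
    refine ⟨⟨⟨A', _⟩, hA', hA'0, hd'⟩, y, hAA, hvol, min_le_left _ _, h2, M, hM, ?_⟩
    calc (M : ℝ≥0∞) * (2 * min (d / 2) (2 * ((M : ℝ≥0∞) + 1))⁻¹)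
        ≤ (M + 1) * (2 * (2 * ((M : ℝ≥0∞) + 1))⁻¹) :=
          mul_le_mul' le_self_add (mul_le_mul_right (min_le_right _ _) _)
      _ = (2 * ((M : ℝ≥0∞) + 1)) * (2 * ((M : ℝ≥0∞) + 1))⁻¹ := by ring
      _ ≤ 1 := ENNReal.mul_inv_le_one _
  choose F Y hsub hvol hd h2 hM using step
  let s₀ : State := ⟨⟨Metric.closedBall 0 1, 1⟩, isCompact_closedBall 0 1,
    (Metric.measure_closedBall_pos volume _ one_pos).ne', one_ne_zero⟩
  let S : ℕ → State := fun n => Nat.rec s₀ (fun n s => F n s) n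
  set K : ℕ → Set (Euc N) := fun n => (S n).1.1
  have hKc : ∀ n, IsCompact (K n) := fun n => (S n).2.1
  have hKm : MeasurableSet (⋂ n, K n) := .iInter fun n => (hKc n).measurableSet
  refine ⟨fun n => Y n (S n), ⋂ n, K n, ?_, fun n => ?_⟩
  · exact (hKc 0).of_isClosed_subset (isClosed_iInter fun n => (hKc n).isClosed)
      (iInter_subset K 0)
  obtain ⟨M, hMb, hMd⟩ := hM n (S n)
  set g : Euc N → ℝ := fun x => w n (x - Y n (S n))
  have hg : Measurable g := (hw n).comp (by fun_prop)
  have hloss := measure_sdiff_iInter_le (μ := volume) (K := K) (d := fun n => (S n).1.2)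
    (fun n => hvol n (S n)) (fun n => hd n (S n)) (fun n => hsub n (S n)) (n + 1)
  have h3 : ∫⁻ x in K (n + 1) \ ⋂ n, K n, ‖g x‖ₑ ≤ 1 := by
    calc ∫⁻ x in K (n + 1) \ ⋂ n, K n, ‖g x‖ₑ ≤ ∫⁻ _x in K (n + 1) \ ⋂ n, K n, (M : ℝ≥0∞) :=
          setLIntegral_mono' ((hKc (n + 1)).measurableSet.diff hKm) fun x hx => hMb x hx.1
      _ = M * volume (K (n + 1) \ ⋂ n, K n) := setLIntegral_const _ _
      _ ≤ _ := (mul_le_mul_right hloss _).trans hMd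
  have h4 : ∫⁻ x in K (n + 1), ‖g x‖ₑ =
      (∫⁻ x in ⋂ n, K n, ‖g x‖ₑ) + ∫⁻ x in K (n + 1) \ ⋂ n, K n, ‖g x‖ₑ := by
    rw [← lintegral_inter_add_sdiff _ (K (n + 1)) hKm, inter_eq_right.2 (iInter_subset K (n + 1))]
  have h5 : 1 ≤ ∫⁻ x in ⋂ n, K n, ‖g x‖ₑ := by
    refine (ENNReal.add_le_add_iff_right one_ne_top).1 ?_
    calc (1 : ℝ≥0∞) + 1 = 2 := one_add_one_eq_two
      _ ≤ ∫⁻ x in K (n + 1), ‖g x‖ₑ := h2 n (S n)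
      _ ≤ _ := h4 ▸ add_le_add_right h3 _
  have h6 : ∫⁻ x in ⋂ n, K n, ‖g x‖ₑ ≠ ∞ := by
    refine ne_top_of_le_ne_top (ENNReal.mul_ne_top (natCast_ne_top M)
      (hKc (n + 1)).measure_lt_top.ne) (?_ : _ ≤ (M : ℝ≥0∞) * volume (K (n + 1)))
    calc ∫⁻ x in ⋂ n, K n, ‖g x‖ₑ ≤ ∫⁻ x in K (n + 1), ‖g x‖ₑ :=
          lintegral_mono_set (iInter_subset K (n + 1))
      _ ≤ ∫⁻ _x in K (n + 1), (M : ℝ≥0∞) := setLIntegral_mono' (hKc (n + 1)).measurableSet hMb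
      _ = M * volume (K (n + 1)) := setLIntegral_const _ _
  have h7 : ∫ x in ⋂ n, K n, ‖g x‖ = (∫⁻ x in ⋂ n, K n, ‖g x‖ₑ).toReal :=
    integral_norm_eq_lintegral_enorm hg.aestronglyMeasurable
  calc (1 : ℝ) = (1 : ℝ≥0∞).toReal := by simp
    _ ≤ (∫⁻ x in ⋂ n, K n, ‖g x‖ₑ).toReal := ENNReal.toReal_mono h6 h5
    _ = _ := h7.symm

lemma eventually_locallyIntegrable_of_tendsto_resc {N : ℕ} {u : ℕ → Euc N → ℝ}
    (hum : ∀ k, Measurable (u k))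
    (hvan : ∀ (j : ℕ → ℤ) (y : ℕ → Euc N) (K : Set (Euc N)), IsCompact K →
      Tendsto (fun k => ∫ x in K, |resc N (j k) (y k) (u k) x|) atTop (𝓝 0)) :
    ∀ᶠ k in atTop, LocallyIntegrable (u k) := by
  by_contra hcon
  obtain ⟨κ, hκ, hn⟩ := extraction_of_frequently_atTop (not_eventually.1 hcon)
  obtain ⟨y, K, hK, h1⟩ := exists_translates_integrableOn_compact (fun n => hum (κ n)) hn
  have hlim := (hvan (fun _ => 0) (Function.extend κ y 0) K hK).comp hκ.tendsto_atTop
  obtain ⟨n, hn⟩ := (hlim.eventually (gt_mem_nhds one_pos)).exists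
  refine absurd (h1 n) (not_le.2 ?_)
  simpa [resc, hκ.injective.extend_apply] using hn

lemma setIntegral_abs_resc (N : ℕ) (j : ℤ) (z : Euc N) (u : Euc N → ℝ) :
    ∫ x in Metric.closedBall 0 1, |resc N j (-((2 : ℝ) ^ (-j) • z)) u x| =
      2 ^ (-j) * ∫ x in Metric.closedBall z (2 ^ j), |u x| := by
  have h2 : (0 : ℝ) < 2 ^ j := by positivity
  set G : Euc N → ℝ := (Metric.closedBall z (2 ^ j)).indicator fun x => |u x|
  have key : ∀ x, (Metric.closedBall (0 : Euc N) 1).indicator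
      (fun x => |resc N j (-((2 : ℝ) ^ (-j) • z)) u x|) x =
      2 ^ (((N : ℤ) - 1) * j) * G ((2 : ℝ) ^ j • x + z) := by
    intro x
    have e : (2 : ℝ) ^ j • (x - -((2 : ℝ) ^ (-j) • z)) = (2 : ℝ) ^ j • x + z := by
      rw [sub_neg_eq_add, smul_add, smul_smul, zpow_neg, mul_inv_cancel₀ h2.ne', one_smul]
    have hmem : x ∈ Metric.closedBall (0 : Euc N) 1 ↔
        (2 : ℝ) ^ j • x + z ∈ Metric.closedBall z (2 ^ j) := by
      rw [mem_closedBall_zero_iff, mem_closedBall_iff_norm, add_sub_cancel_right, norm_smul,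
        Real.norm_of_nonneg h2.le, mul_le_iff_le_one_right h2]
    by_cases hx : x ∈ Metric.closedBall (0 : Euc N) 1
    · rw [indicator_of_mem hx]
      simp only [G]
      rw [indicator_of_mem (hmem.1 hx), resc, e, abs_mul, abs_of_pos (by positivity)]
    · rw [indicator_of_notMem hx]
      simp only [G]
      rw [indicator_of_notMem (mt hmem.2 hx), mul_zero]
  rw [← integral_indicator Metric.isClosed_closedBall.measurableSet,
    ← integral_indicator Metric.isClosed_closedBall.measurableSet]
  simp_rw [key]
  rw [integral_const_mul, Measure.integral_comp_smul volume (fun x => G (x + z)),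
    integral_add_right_eq_self G z, finrank_euclideanSpace_fin, smul_eq_mul, ← mul_assoc,
    abs_of_pos (by positivity)]
  congr 1
  rw [← zpow_natCast, ← zpow_mul, ← zpow_neg, ← zpow_add₀ two_ne_zero]
  congr 1
  ring

lemma eventually_setLIntegral_ball_le_of_tendsto_resc {N : ℕ} {u : ℕ → Euc N → ℝ}
    (hum : ∀ k, Measurable (u k))
    (hvan : ∀ (j : ℕ → ℤ) (y : ℕ → Euc N) (K : Set (Euc N)), IsCompact K →
      Tendsto (fun k => ∫ x in K, |resc N (j k) (y k) (u k) x|) atTop (𝓝 0))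
    {η : ℝ} (hη : 0 < η) :
    ∀ᶠ k in atTop, ∀ (j : ℤ) (z : Euc N),
      ∫⁻ x in Metric.ball z (2 ^ j), ‖u k x‖ₑ ≤ ENNReal.ofReal (η * 2 ^ j) := by
  have hsel : ∀ k, ∃ (j : ℤ) (z : Euc N),
      (∫⁻ x in Metric.ball z (2 ^ j), ‖u k x‖ₑ ≤ ENNReal.ofReal (η * 2 ^ j)) →
      ∀ (j : ℤ) (z : Euc N),
        ∫⁻ x in Metric.ball z (2 ^ j), ‖u k x‖ₑ ≤ ENNReal.ofReal (η * 2 ^ j) := by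
    intro k
    by_contra! hcon
    obtain ⟨-, j, z, h⟩ := hcon 0 0
    exact absurd (hcon j z).1 (not_le.2 h)
  choose J Z hJ using hsel
  have hlim := hvan J (fun k => -((2 : ℝ) ^ (-J k) • Z k)) _ (isCompact_closedBall 0 1)
  simp only [setIntegral_abs_resc] at hlim
  filter_upwards [hlim.eventually (gt_mem_nhds hη),
    eventually_locallyIntegrable_of_tendsto_resc hum hvan] with k hk hL
  refine hJ k ?_
  have h2 : (0 : ℝ) < 2 ^ J k := by positivity
  have hintg : IntegrableOn (u k) (Metric.closedBall (Z k) (2 ^ J k)) :=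
    hL.integrableOn_isCompact (isCompact_closedBall _ _)
  calc ∫⁻ x in Metric.ball (Z k) (2 ^ J k), ‖u k x‖ₑ
      ≤ ∫⁻ x in Metric.closedBall (Z k) (2 ^ J k), ‖u k x‖ₑ :=
        lintegral_mono_set Metric.ball_subset_closedBall
    _ = ENNReal.ofReal (∫ x in Metric.closedBall (Z k) (2 ^ J k), |u k x|) :=
        (ofReal_integral_norm_eq_lintegral_enorm hintg).symm
    _ ≤ ENNReal.ofReal (η * 2 ^ J k) := by
        refine ENNReal.ofReal_le_ofReal ?_
        rw [zpow_neg, inv_mul_eq_div, div_lt_iff₀ h2] at hk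
        exact hk.le

/-- If the integrals of `|u|` over balls are small compared to the radius, then the weak Lorentz
norm of `u` is small. -/
lemma exists_weak_lorentz_le {N : ℕ} (hN : 2 ≤ N) (n : ℕ) :
    ∃ η : ℝ, 0 < η ∧ ∀ u : Euc N → ℝ, LocallyIntegrable u → Measurable u →
      TV N u univ ≠ ∞ →
      (∀ (j : ℤ) (z : Euc N),
        ∫⁻ x in Metric.ball z (2 ^ j), ‖u x‖ₑ ≤ ENNReal.ofReal (η * 2 ^ j)) →
      ∀ i : ℤ, ENNReal.ofReal (((2 : ℝ) ^ (N - 1)) ^ i) *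
          volume {x | ((2 : ℝ) ^ (N - 1)) ^ i < |u x|} ^ (1 / ((N : ℝ) / ((N : ℝ) - 1))) ≤
        (TV N u univ * ENNReal.ofReal (2 * 2⁻¹ ^ n)) ^ (1 / ((N : ℝ) / ((N : ℝ) - 1))) := by
  obtain ⟨m, rfl⟩ : ∃ m, N = m + 1 := ⟨N - 1, by omega⟩
  have hm : (0 : ℝ) < m := by exact_mod_cast (by omega : 0 < m)
  set ω := volume.real (Metric.ball (0 : Euc (m + 1)) 1)
  have hω : 0 < ω := ENNReal.toReal_pos (Metric.measure_ball_pos volume _ one_pos).ne'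
    measure_ball_lt_top.ne
  have hωe : volume (Metric.ball (0 : Euc (m + 1)) 1) = ENNReal.ofReal ω :=
    (ENNReal.ofReal_toReal measure_ball_lt_top.ne).symm
  refine ⟨ω / 2 * (2⁻¹ ^ n) ^ m, by positivity, fun u hu hum hTV hav i => ?_⟩
  simp only [Nat.add_sub_cancel, Nat.cast_add, Nat.cast_one, add_sub_cancel_right, one_div_div]
  set r : ℝ := m / (m + 1)
  have hr : 0 ≤ r := by positivity
  set t : ℝ := 2 ^ i
  have ht : 0 < t := by positivity
  have hti : ((2 : ℝ) ^ m) ^ i = t ^ m := by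
    rw [← zpow_natCast, ← zpow_natCast, ← zpow_mul, ← zpow_mul, mul_comm]
  have hs : (2 : ℝ) ^ (-i - n) = t⁻¹ * 2⁻¹ ^ n := by
    rw [zpow_sub₀ two_ne_zero, zpow_neg, zpow_natCast, inv_pow, div_eq_mul_inv]
  have hlev := measure_level_le_of_averages_le hu hum hTV (s := 2 ^ (-i - (n : ℤ)))
    (l := t ^ m / 2) (by positivity) (by positivity) fun z => by
      refine (hav _ z).trans (le_of_eq ?_)
      rw [Measure.addHaar_ball _ _ (by positivity), hωe, finrank_euclideanSpace_fin,
        ← ENNReal.ofReal_mul (by positivity), ← ENNReal.ofReal_mul (by positivity), hs]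
      congr 1
      generalize (2⁻¹ : ℝ) ^ n = a
      rw [mul_pow, inv_pow, pow_succ t, pow_succ a]
      field_simp
  rw [mul_div_cancel₀ _ two_ne_zero, hs, mul_div_assoc,
    ← ENNReal.ofReal_div_of_pos (by positivity)] at hlev
  have htr : ENNReal.ofReal (t ^ m) = ENNReal.ofReal (t ^ (m + 1)) ^ r := by
    rw [ENNReal.ofReal_rpow_of_nonneg (by positivity) hr, ← Real.rpow_natCast t (m + 1),
      ← Real.rpow_mul ht.le, ← Real.rpow_natCast]
    congr 2
    simp only [r]
    push_cast
    field_simp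
  rw [hti, htr, ← ENNReal.mul_rpow_of_nonneg _ _ hr]
  refine ENNReal.rpow_le_rpow ((mul_le_mul_right hlev _).trans (le_of_eq ?_)) hr
  rw [mul_left_comm, ← ENNReal.ofReal_mul (by positivity)]
  congr 2
  field_simp
  ring

/-- cocompactness of `BV̇(ℝ^N) ↪ L^{1*,q}(ℝ^N)` for `1 < q ≤ 1* = N/(N-1)`,
with respect to the rescaling group `D`. -/
theorem cocompact_BVdot_into_Lorentz
    (N : ℕ) (hN : 2 ≤ N) (q : ℝ) (hq1 : 1 < q) (hq2 : q ≤ (N : ℝ) / ((N : ℝ) - 1))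
    (u : ℕ → Euc N → ℝ) (hmem : ∀ k, MemBVdot N (u k))
    (hbdd : ∃ C : ℝ≥0∞, C ≠ ∞ ∧ ∀ k, TV N (u k) univ ≤ C)
    (hvan : ∀ (j : ℕ → ℤ) (y : ℕ → Euc N),
      WeakBVconv N (fun k => resc N (j k) (y k) (u k)) 0) :
    Tendsto (fun k => lorentz N ((N : ℝ) / ((N : ℝ) - 1)) (ENNReal.ofReal q) (u k))
      atTop (𝓝 0) := by
  obtain ⟨C, hC, hTV⟩ := hbdd
  have hvan' : ∀ (j : ℕ → ℤ) (y : ℕ → Euc N) (K : Set (Euc N)), IsCompact K →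
      Tendsto (fun k => ∫ x in K, |resc N (j k) (y k) (u k) x|) atTop (𝓝 0) := by
    intro j y K hK
    simpa using (hvan j y).1 K hK
  have hum : ∀ k, Measurable (u k) := fun k => (hmem k).1
  have hN' : (2 : ℝ) ≤ N := by exact_mod_cast hN
  have hN1 : (0 : ℝ) < (N : ℝ) - 1 := by linarith
  set p : ℝ := (N : ℝ) / ((N : ℝ) - 1)
  have hp0 : 0 < p := div_pos (by linarith) hN1
  have hp : (N : ℝ).HolderConjugate p := Real.HolderConjugate.conjExponent (by linarith)
  have hq0 : 0 < q := by linarith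
  have hD : (2 : ℝ) ≤ 2 ^ (N - 1) := le_self_pow₀ one_le_two (by omega)
  obtain ⟨M, hM, hsum⟩ := exists_tsum_level_bound N hp hD
  set A : ℝ≥0∞ := ENNReal.ofReal (((2 : ℝ) ^ (N - 1)) ^ q) * ENNReal.ofReal (q / p)⁻¹
  set d : ℕ → ℝ≥0∞ := fun n => (C * ENNReal.ofReal (2 * 2⁻¹ ^ n)) ^ (1 / p)
  have hd : Tendsto (fun n => (A * (d n ^ (q - 1) * (M * C))) ^ (1 / q)) atTop (𝓝 0) := by
    have h1 : Tendsto (fun n : ℕ => ENNReal.ofReal (2 * 2⁻¹ ^ n)) atTop (𝓝 0) := by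
      simpa using ENNReal.tendsto_ofReal
        ((tendsto_pow_atTop_nhds_zero_of_lt_one (by norm_num : (0 : ℝ) ≤ 2⁻¹)
          (by norm_num)).const_mul 2)
    have h2 : Tendsto d atTop (𝓝 0) := by
      have := (ENNReal.Tendsto.const_mul h1 (Or.inr hC)).ennrpow_const (1 / p)
      rwa [mul_zero, ENNReal.zero_rpow_of_pos (by positivity)] at this
    have h3 := h2.ennrpow_const (q - 1)
    rw [ENNReal.zero_rpow_of_pos (by linarith)] at h3
    have h4 := (ENNReal.Tendsto.const_mul (ENNReal.Tendsto.mul_const h3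
      (Or.inr (ENNReal.mul_ne_top hM hC))) (Or.inr (ENNReal.mul_ne_top ofReal_ne_top
        ofReal_ne_top : A ≠ ∞))).ennrpow_const (1 / q)
    rwa [zero_mul, mul_zero, ENNReal.zero_rpow_of_pos (by positivity)] at h4
  rw [ENNReal.tendsto_nhds_zero]
  intro ε hε
  obtain ⟨n, hn⟩ := (hd.eventually (gt_mem_nhds hε)).exists
  obtain ⟨η, hη, hweak⟩ := exists_weak_lorentz_le hN n
  filter_upwards [eventually_locallyIntegrable_of_tendsto_resc hum hvan',
    eventually_setLIntegral_ball_le_of_tendsto_resc hum hvan' hη] with k hL hav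
  refine le_trans ?_ hn.le
  have hTVk : TV N (u k) univ ≠ ∞ := (hmem k).2.2.ne
  have hsumk := (hsum (u k) hL (hmem k)).trans (mul_le_mul_right (hTV k) M)
  refine (lorentz_le_tsum_levels N hp0 hq0 (by linarith : (1 : ℝ) < 2 ^ (N - 1))).trans ?_
  refine ENNReal.rpow_le_rpow (mul_le_mul_right ?_ _) (by positivity)
  refine (tsum_rpow_le_of_le hq1 (fun i => (hweak (u k) hL (hum k) hTVk hav i).trans
    (ENNReal.rpow_le_rpow (mul_le_mul_left (hTV k) _) (by positivity)))
    (ne_top_of_le_ne_top (ENNReal.mul_ne_top hM hC) hsumk)).trans ?_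
  exact mul_le_mul_right hsumk _
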